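/- arXiv:2002.08989 — 7 statements merged into one kernel-verified Lean document; each statement's English description precedes it below -/
import Mathlib

section
/- Let f be an order embedding of a partial order P' with well-founded < into a partial order P with well-founded <. If for all x, y in P', Level_{P'}(x) = Level_{P'}(y) implies Level_P(f(x)) = Level_P(f(y)), then the converse implication also holds for all x, y in P', and moreover for all x, y in P', Level_{P'}(x) < Level_{P'}(y) if and only if Level_P(f(x)) < Level_P(f(y)). -/
universe u

/-- The level of an element `x` of a partial order with well-founded `<`:
`Level(x) = sup { Level(y) + 1 : y < x }`, i.e. the rank of `x` with respect to `<`. -/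
noncomputable def level (α : Type u) [PartialOrder α] [WellFoundedLT α] (x : α) : Ordinal.{u} :=
  IsWellFounded.rank (α := α) (· < ·) x

/-- Two elements of a partial order are incomparable. -/
def Incomp {α : Type u} [Preorder α] (a b : α) : Prop := ¬ a ≤ b ∧ ¬ b ≤ a

/-- An order embedding `f : α ↪o β` is level-induced when
`Level(x) = Level(y) ↔ Level(f x) = Level(f y)` for all `x y`. -/
def LevelInduced {α β : Type u} [PartialOrder α] [WellFoundedLT α]
    [PartialOrder β] [WellFoundedLT β] (f : α ↪o β) : Prop :=
  ∀ x y : α, level α x = level α y ↔ level β (f x) = level β (f y)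

/-- The gap between two elements: `max(Level x, Level y) - min(Level x, Level y)`
(ordinal subtraction). -/
noncomputable def gap (α : Type u) [PartialOrder α] [WellFoundedLT α] (x y : α) : Ordinal.{u} :=
  max (level α x) (level α y) - min (level α x) (level α y)

/-- An order embedding `f : α ↪o β` is consecutive level-induced when it preserves gaps. -/
def ConsecutiveLevelInduced {α β : Type u} [PartialOrder α] [WellFoundedLT α]
    [PartialOrder β] [WellFoundedLT β] (f : α ↪o β) : Prop :=
  ∀ x y : α, gap α x y = gap β (f x) (f y)

/-- `α` is an ali order: whenever `α` order-embeds into a partial order `β` with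
well-founded `<`, there is a level-induced order embedding of `α` into `β`. -/
def AliOrder (α : Type u) [PartialOrder α] [WellFoundedLT α] : Prop :=
  ∀ (β : Type u) [PartialOrder β] [WellFoundedLT β],
    Nonempty (α ↪o β) → ∃ f : α ↪o β, LevelInduced f

/-- `α` is a nacli order: whenever there is a level-induced order embedding of `α` into a
partial order `β` with well-founded `<`, there is a consecutive level-induced order
embedding of `α` into `β`. -/
def NacliOrder (α : Type u) [PartialOrder α] [WellFoundedLT α] : Prop :=
  ∀ (β : Type u) [PartialOrder β] [WellFoundedLT β],
    (∃ f : α ↪o β, LevelInduced f) → ∃ g : α ↪o β, ConsecutiveLevelInduced g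

theorem exists_lt_level {α : Type u} [PartialOrder α] [WellFoundedLT α] (o : Ordinal.{u}) (y : α) :
    o < level α y → ∃ z, z < y ∧ level α z = o := by
  induction y using WellFoundedLT.induction with
  | ind y ih =>
    intro ho
    by_contra hc
    push Not at hc
    refine absurd ho (not_lt.mpr ?_)
    unfold level
    rw [IsWellFounded.rank_eq]
    refine Ordinal.iSup_le ?_
    rintro ⟨z, hz⟩
    refine Order.succ_le_of_lt ?_
    change level α z < o
    refine lt_of_le_of_ne (not_lt.mp fun hlt => ?_) (hc z hz)
    obtain ⟨w, hw, hwo⟩ := ih z hz hlt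
    exact hc w (hw.trans hz) hwo

/-- If an order embedding sends equal levels to equal levels, then it also reflects
equality of levels, and it preserves and reflects strict comparison of levels. -/
theorem stmt2 {α β : Type u} [PartialOrder α] [WellFoundedLT α]
    [PartialOrder β] [WellFoundedLT β] (f : α ↪o β)
    (h : ∀ x y : α, level α x = level α y → level β (f x) = level β (f y)) :
    (∀ x y : α, level β (f x) = level β (f y) → level α x = level α y) ∧
    (∀ x y : α, level α x < level α y ↔ level β (f x) < level β (f y)) := by
  have key : ∀ x y : α, level α x < level α y → level β (f x) < level β (f y) := by
    intro x y hxy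
    obtain ⟨z, hz, hzx⟩ := exists_lt_level _ y hxy
    rw [← h z x hzx]
    exact IsWellFounded.rank_lt_of_rel (r := (· < ·)) (f.lt_iff_lt.mpr hz)
  have conv : ∀ x y : α, level β (f x) = level β (f y) → level α x = level α y := by
    intro x y hxy
    rcases lt_trichotomy (level α x) (level α y) with hl | he | hg
    · exact absurd hxy (key x y hl).ne
    · exact he
    · exact absurd hxy (key y x hg).ne'
  refine ⟨conv, fun x y => ⟨key x y, fun hxy => ?_⟩⟩
  rcases lt_trichotomy (level α x) (level α y) with hl | he | hg
  · exact hl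
  · exact absurd (h x y he) hxy.ne
  · exact absurd (key y x hg) hxy.not_gt
end

section
/- For every partial order P' with well-founded <, there exists a partial order P with well-founded < and an order embedding of P' into P such that: (i) every level of P has at most 2 elements (for each ordinal β, the set {x ∈ P : Level_P(x) = β} has cardinality at most 2), and (ii) P contains no level-induced copy of O_obs1, i.e., there are no elements a, b, c, d of P with a < b, c < d, all pairs among {a,c}, {a,d}, {b,c}, {b,d} incomparable, Level_P(a) = Level_P(c), and Level_P(b) = Level_P(d). -/
universe u

/-- A bundled partial order with well-founded `<`. -/
structure WFOrder : Type (u + 1) where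
  carrier : Type u
  [po : PartialOrder carrier]
  [wf : WellFoundedLT carrier]

attribute [instance] WFOrder.po WFOrder.wf

def WExt (α : Type u) (_s : α → α → Prop) : Type u := α ⊕ α

namespace WExt

variable {α : Type u} [PartialOrder α] {s : α → α → Prop}

def le (s : α → α → Prop) : α ⊕ α → α ⊕ α → Prop
  | .inl x, .inl y => x ≤ y
  | .inr z, .inl y => s z y
  | .inr z, .inr w => z = w ∨ s z w
  | .inl _, .inr _ => False

def pr : α ⊕ α → α
  | .inl x => x
  | .inr x => x

@[reducible] def po (s : α → α → Prop) [IsWellOrder α s] (h : ∀ x y : α, x < y → s x y) :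
    PartialOrder (WExt α s) where
  le := le s
  le_refl := by rintro (x | x) <;> simp [le]
  le_trans := by
    have h' : ∀ x y : α, x ≤ y → x = y ∨ s x y := fun x y hxy =>
      (eq_or_lt_of_le hxy).imp id (h x y)
    have ht : ∀ x y z : α, s x y → s y z → s x z := fun x y z => _root_.trans
    rintro (x | x) (y | y) (z | z) <;> simp only [le] <;> grind
  le_antisymm := by
    have ht : ∀ x y : α, s x y → ¬ s y x := fun x y => asymm
    rintro (x | x) (y | y) <;> simp only [le] <;> intro h1 h2
    · exact congrArg _ (le_antisymm h1 h2)
    · exact h1.elim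
    · exact h2.elim
    · congr 1; grind

theorem pr_lt [IsWellOrder α s] (h : ∀ x y : α, x < y → s x y) (p q : α ⊕ α)
    (h1 : le s p q) (h2 : ¬ le s q p) : s (pr p) (pr q) := by
  rcases p with x | x <;> rcases q with y | y <;> simp only [le, pr] at *
  · exact h _ _ (lt_of_le_not_ge h1 h2)
  · exact h1
  · grind

theorem lt_of (p : α ⊕ α) (z : α) [IsWellOrder α s] (h : s z (pr p)) :
    le s (.inr z) p ∧ ¬ le s p (.inr z) := by
  have ht : ∀ x y : α, s x y → ¬ s y x := fun x y => asymm
  rcases p with x | x <;> simp only [le, pr] at * <;> grind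

end WExt

/-- Every partial order with well-founded `<` embeds in a partial order with well-founded `<`
all of whose levels have at most 2 elements and which has no level-induced copy of `O_obs1`. -/
theorem stmt3 (α : Type u) [PartialOrder α] [WellFoundedLT α] :
    ∃ (B : WFOrder.{u}) (_f : α ↪o B.carrier),
      (∀ o : Ordinal.{u}, Cardinal.mk {x : B.carrier | level B.carrier x = o} ≤ 2) ∧
      ¬ ∃ a b c d : B.carrier, a < b ∧ c < d ∧
          Incomp a c ∧ Incomp a d ∧ Incomp b c ∧ Incomp b d ∧
          level B.carrier a = level B.carrier c ∧ level B.carrier b = level B.carrier d := by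
  obtain ⟨s, hs, hw⟩ := IsWellFounded.exists_well_order_ge (α := α) (· < ·)
  have h : ∀ x y : α, x < y → s x y := fun x y => hs x y
  letI := WExt.po s h
  have hlt : ∀ p q : WExt α s, p < q → s (WExt.pr p) (WExt.pr q) := fun p q hpq =>
    WExt.pr_lt h p q hpq.le hpq.not_ge
  have hinr : ∀ (z : α) (p : WExt α s), s z (WExt.pr p) →
      LT.lt (α := WExt α s) (Sum.inr z : α ⊕ α) p := fun z p hz =>
    lt_of_le_not_ge (α := WExt α s) (WExt.lt_of p z hz).1 (WExt.lt_of p z hz).2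
  haveI : WellFoundedLT (WExt α s) :=
    ⟨Subrelation.wf (fun {p q} hpq => hlt p q hpq) (InvImage.wf WExt.pr hw.wf)⟩
  have hlev : ∀ (x : α) (p : WExt α s), WExt.pr p = x →
      level (WExt α s) p = IsWellFounded.rank s x := by
    intro x
    induction x using hw.wf.induction with
    | _ x ih =>
    rintro p rfl
    apply le_antisymm
    · unfold level
      rw [IsWellFounded.rank_eq]
      refine Ordinal.iSup_le ?_
      rintro ⟨q, hq⟩
      have := ih _ (hlt _ _ hq) q rfl
      unfold level at this
      rw [this]
      exact Order.succ_le_of_lt (IsWellFounded.rank_lt_of_rel (hlt _ _ hq))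
    · rw [IsWellFounded.rank_eq]
      refine Ordinal.iSup_le ?_
      rintro ⟨z, hz⟩
      rw [← ih z hz (Sum.inr z : α ⊕ α) rfl]
      exact Order.succ_le_of_lt (IsWellFounded.rank_lt_of_rel (hinr z p hz))
  have hinj : ∀ p q : WExt α s, level _ p = level _ q → WExt.pr p = WExt.pr q := by
    intro p q hpq
    rw [hlev _ p rfl, hlev _ q rfl] at hpq
    rcases trichotomous_of s (WExt.pr p) (WExt.pr q) with h1 | h1 | h1
    · exact absurd hpq (IsWellFounded.rank_lt_of_rel h1).ne
    · exact h1
    · exact absurd hpq (IsWellFounded.rank_lt_of_rel h1).ne'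
  refine ⟨⟨WExt α s⟩, ⟨⟨fun x => (Sum.inl x : α ⊕ α), fun x y hxy => Sum.inl.inj hxy⟩, Iff.rfl⟩,
    ?_, ?_⟩
  · intro o
    have : Function.Injective (fun p : {x : WExt α s | level (WExt α s) x = o} =>
        (ULift.up (Sum.isLeft (p.1 : α ⊕ α)) : ULift.{u} Bool)) := by
      rintro ⟨p, hp⟩ ⟨q, hq⟩ hpq
      have h1 := hinj p q (hp.trans hq.symm)
      apply Subtype.ext
      rcases p with x | x <;> rcases q with y | y <;> simp [WExt.pr] at * <;> rw [h1]
    have := Cardinal.mk_le_of_injective this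
    simpa using this
  · rintro ⟨a, b, c, d, hab, hcd, hac, had, hbc, hbd, l1, l2⟩
    have e1 := hinj _ _ l1
    have e2 := hinj _ _ l2
    have s1 := hlt _ _ hab
    have s2 := hlt _ _ hcd
    rcases a with a | a
    · rcases c with c | c
      · obtain rfl : a = c := e1
        exact hac.1 le_rfl
      · exact hbc.2 (hinr c b (by rw [e2]; exact s2)).le
    · exact had.1 (hinr a d (by rw [← e2]; exact s1)).le
end

section
/- Every ali order P' has level-width at most 2 (for each ordinal β, the set {x ∈ P' : Level_{P'}(x) = β} has cardinality at most 2) and contains no level-induced copy of O_obs1, i.e., there are no elements a, b, c, d of P' with a < b, c < d, all pairs among {a,c}, {a,d}, {b,c}, {b,d} incomparable, Level_{P'}(a) = Level_{P'}(c), and Level_{P'}(b) = Level_{P'}(d). -/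
universe u

/-- the comb over `α`: a chain copy (`true`) and an original copy (`false`) -/
structure Comb (α : Type u) where
  b : Bool
  v : α

def combLe {α : Type u} [PartialOrder α] (g : α → Ordinal.{u}) (x y : Comb α) : Prop :=
  match x, y with
  | ⟨true, a⟩, ⟨true, b⟩ => g a ≤ g b
  | ⟨true, a⟩, ⟨false, b⟩ => g a < g b
  | ⟨false, a⟩, ⟨false, b⟩ => a ≤ b
  | ⟨false, _⟩, ⟨true, _⟩ => False

@[reducible] def combOrder {α : Type u} [PartialOrder α] (g : α → Ordinal.{u}) (hi : Function.Injective g)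
    (hm : StrictMono g) : PartialOrder (Comb α) where
  le := combLe g
  le_refl := by rintro ⟨_ | _, a⟩ <;> simp [combLe]
  le_trans := by
    rintro ⟨_ | _, a⟩ ⟨_ | _, b⟩ ⟨_ | _, c⟩ <;> simp only [combLe] <;> intro h1 h2
    · exact h1.trans h2
    · exact h2
    · exact h1.elim
    · exact h1.elim
    · exact h1.trans_le (hm.monotone h2)
    · exact h2.elim
    · exact h1.trans_lt h2
    · exact h1.trans h2
  le_antisymm := by
    rintro ⟨_ | _, a⟩ ⟨_ | _, b⟩ <;> simp only [combLe] <;> intro h1 h2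
    · rw [le_antisymm h1 h2]
    · exact h1.elim
    · exact h2.elim
    · rw [hi (le_antisymm h1 h2)]

theorem exists_ext (α : Type u) [PartialOrder α] [WellFoundedLT α] :
    ∃ g : α → Ordinal.{u}, Function.Injective g ∧ StrictMono g := by
  obtain ⟨s, hle, hs⟩ := IsWellFounded.exists_well_order_ge (α := α) (· < ·)
  refine ⟨fun x => Ordinal.typein s x, Ordinal.typein_injective s, fun x y hxy => ?_⟩
  exact (Ordinal.typein_lt_typein s).2 (hle _ _ hxy)

theorem key (α : Type u) [PartialOrder α] [WellFoundedLT α] (h : AliOrder α) :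
    ∃ (g : α → Ordinal.{u}) (F : α → Comb α),
      (∀ x y, x ≤ y ↔ combLe g (F x) (F y)) ∧
      (∀ x y, level α x = level α y → (F x).v = (F y).v) := by
  obtain ⟨g, hi, hm⟩ := exists_ext α
  letI : PartialOrder (Comb α) := combOrder g hi hm
  have le_def : ∀ x y : Comb α, x ≤ y ↔ combLe g x y := fun _ _ => Iff.rfl
  have ltg : ∀ x y : Comb α, x < y → g x.v < g y.v := by
    intro x y hxy
    obtain ⟨h1, h2⟩ := lt_iff_le_not_ge.1 hxy
    rw [le_def] at h1 h2
    obtain ⟨_ | _, a⟩ := x <;> obtain ⟨_ | _, b⟩ := y <;> simp only [combLe] at h1 h2 ⊢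
    · exact hm (lt_of_le_not_ge h1 h2)
    · exact h1
    · exact lt_of_not_ge h2
  haveI : WellFoundedLT (Comb α) :=
    ⟨Subrelation.wf (fun {x y} h => ltg x y h) (InvImage.wf (fun x : Comb α => g x.v) wellFounded_lt)⟩
  have cc : ∀ a b : α, g a < g b → (⟨true, a⟩ : Comb α) < ⟨true, b⟩ := by
    intro a b hab
    rw [lt_iff_le_not_ge, le_def, le_def]
    exact ⟨hab.le, hab.not_ge⟩
  have cx : ∀ a b : α, g a < g b → (⟨true, a⟩ : Comb α) < ⟨false, b⟩ := by
    intro a b hab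
    rw [lt_iff_le_not_ge, le_def, le_def]
    exact ⟨hab, id⟩
  have lvlt : ∀ x y : Comb α, x < y → level _ x < level _ y := fun x y h =>
    IsWellFounded.rank_lt_of_rel h
  have lvle : ∀ (x : Comb α) (o : Ordinal.{u}), (∀ y, y < x → level _ y < o) → level _ x ≤ o := by
    intro x o ho
    unfold level at *
    rw [IsWellFounded.rank_eq]
    exact Ordinal.iSup_le fun y => Order.succ_le_of_lt (ho y.1 y.2)
  have lv : ∀ a : α, level (Comb α) ⟨false, a⟩ = level (Comb α) ⟨true, a⟩ := by
    intro a
    induction a using WellFoundedLT.induction with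
    | ind a ih =>
    apply le_antisymm
    · apply lvle
      rintro ⟨_ | _, b⟩ hb
      · have hba : b < a := 
          lt_of_le_not_ge ((le_def _ _).1 hb.le) (fun hh => hb.not_ge ((le_def _ _).2 hh))
        rw [ih b hba]
        exact lvlt _ _ (cc _ _ (hm hba))
      · exact lvlt _ _ (cc _ _ (ltg _ _ hb))
    · apply lvle
      rintro ⟨_ | _, b⟩ hb
      · exact ((le_def _ _).1 hb.le).elim
      · exact lvlt _ _ (cx _ _ (ltg _ _ hb))
  have lv' : ∀ x : Comb α, level (Comb α) x = level (Comb α) ⟨true, x.v⟩ := by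
    rintro ⟨_ | _, a⟩
    · exact lv a
    · rfl
  obtain ⟨f, hf⟩ := h (Comb α) ⟨⟨⟨fun a => ⟨false, a⟩, fun a b hab => by simpa using hab⟩, Iff.rfl⟩⟩
  refine ⟨g, f, fun x y => f.le_iff_le.symm, fun x y hxy => ?_⟩
  have := (hf x y).1 hxy
  rw [lv', lv' (f y)] at this
  apply hi
  rcases lt_trichotomy (g (f x).v) (g (f y).v) with h1 | h1 | h1
  · exact absurd this (lvlt _ _ (cc _ _ h1)).ne
  · exact h1
  · exact absurd this (lvlt _ _ (cc _ _ h1)).ne'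

/-- Every ali order has level-width at most 2 and contains no level-induced copy of `O_obs1`. -/
theorem stmt4 (α : Type u) [PartialOrder α] [WellFoundedLT α] (h : AliOrder α) :
    (∀ o : Ordinal.{u}, Cardinal.mk {x : α | level α x = o} ≤ 2) ∧
    ¬ ∃ a b c d : α, a < b ∧ c < d ∧
        Incomp a c ∧ Incomp a d ∧ Incomp b c ∧ Incomp b d ∧
        level α a = level α c ∧ level α b = level α d := by
  obtain ⟨g, F, hF, hl⟩ := key α h
  have Finj : ∀ x y, F x = F y → x = y := fun x y hxy =>
    le_antisymm ((hF x y).2 (hxy ▸ (hF x x).1 le_rfl)) ((hF y x).2 (hxy ▸ (hF x x).1 le_rfl))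
  constructor
  · intro o
    have : Function.Injective (fun x : {x : α | level α x = o} => ULift.up.{u} (F x.1).b) := by
      rintro ⟨x, hx⟩ ⟨y, hy⟩ hxy
      have h1 : (F x).b = (F y).b := by simpa using hxy
      have h2 := hl x y (hx.trans hy.symm)
      have : F x = F y := by
        cases hx : F x; cases hy : F y; simp_all
      exact Subtype.ext (Finj _ _ this)
    simpa using Cardinal.mk_le_of_injective this
  · rintro ⟨a, b, c, d, hab, hcd, hac, had, hbc, hbd, h1, h2⟩
    have e1 := hl _ _ h1
    have e2 := hl _ _ h2
    have hab' := (lt_iff_le_not_ge.1 hab)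
    have hcd' := (lt_iff_le_not_ge.1 hcd)
    simp only [Incomp, hF] at *
    generalize F a = A at *
    generalize F b = B at *
    generalize F c = C at *
    generalize F d = D at *
    obtain ⟨_ | _, a⟩ := A <;> obtain ⟨_ | _, b⟩ := B <;> obtain ⟨_ | _, c⟩ := C <;>
      obtain ⟨_ | _, d⟩ := D <;> simp only [combLe] at * <;> subst e1 <;> subst e2 <;> grind
end

section
/- No ali order has a level of size 2 except possibly the first: if P' is an ali order and x ≠ y are elements of P' with Level_{P'}(x) = Level_{P'}(y), then Level_{P'}(x) = 0. -/
universe u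

theorem exists_rk (α : Type u) [PartialOrder α] [WellFoundedLT α] :
    ∃ r : α → Ordinal.{u}, StrictMono r ∧ Function.Injective r ∧
      ∀ p, ∀ o < r p, ∃ q, r q = o := by
  obtain ⟨s, hs, hw⟩ := IsWellFounded.exists_well_order_ge (α := α) (· < ·)
  refine ⟨fun p => IsWellFounded.rank s p, ?_, ?_, ?_⟩
  · intro a b hab
    exact IsWellFounded.rank_lt_of_rel (hs a b hab)
  · intro a b hab
    rcases trichotomous_of s a b with h | h | h
    · exact absurd hab (IsWellFounded.rank_lt_of_rel h).ne
    · exact h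
    · exact absurd hab (IsWellFounded.rank_lt_of_rel h).ne'
  · intro p o ho
    have : o ∈ Set.range (IsWellFounded.rank s) := IsWellFounded.mem_range_rank_of_le ho.le
    exact this

theorem level_eq_of {β : Type u} [PartialOrder β] [WellFoundedLT β] (ρ : β → Ordinal.{u})
    (h1 : StrictMono ρ) (h2 : ∀ z, ∀ o < ρ z, ∃ w, w < z ∧ ρ w = o) (z : β) :
    level β z = ρ z := by
  induction z using WellFoundedLT.induction with
  | ind z ih =>
    unfold level at *
    apply le_antisymm
    · rw [IsWellFounded.rank_eq]
      apply Ordinal.iSup_le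
      rintro ⟨w, hw⟩
      have hw' : w < z := hw
      simp only [ih w hw']
      exact Order.succ_le_of_lt (h1 hw')
    · by_contra! hc
      obtain ⟨w, hw, he⟩ := h2 z _ hc
      have := IsWellFounded.rank_lt_of_rel (r := (· < ·)) hw
      rw [ih w hw, he] at this
      exact lt_irrefl _ this

/-- `α` together with disjoint chains, one for each `i : ι`. -/
abbrev ChainExt {α ι : Type u} (g : α → ι) (r : α → Ordinal.{u}) : Type u :=
  α ⊕ {t : ι × α // ∃ p, g p = t.1 ∧ r t.2 < r p}

def ExtLe {α ι : Type u} [PartialOrder α] (g : α → ι) (r : α → Ordinal.{u}) :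
    ChainExt g r → ChainExt g r → Prop
  | .inl a, .inl b => a ≤ b
  | .inl _, .inr _ => False
  | .inr t, .inl p => ∃ p', p' ≤ p ∧ g p' = t.1.1 ∧ r t.1.2 < r p'
  | .inr t, .inr v => t.1.1 = v.1.1 ∧ r t.1.2 ≤ r v.1.2

abbrev extOrder {α ι : Type u} [PartialOrder α] (g : α → ι) (r : α → Ordinal.{u})
    (hi : Function.Injective r) : PartialOrder (ChainExt g r) where
  le := ExtLe g r
  le_refl := by
    rintro (a | t)
    · exact le_refl a
    · exact ⟨rfl, le_refl _⟩
  le_trans := by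
    rintro (a | t) (b | v) (c | w) h1 h2
    · exact le_trans (α := α) h1 h2
    · exact h2
    · exact h1.elim
    · exact h1.elim
    · obtain ⟨p, hp, h⟩ := h1
      exact ⟨p, le_trans (α := α) hp h2, h⟩
    · exact h2.elim
    · obtain ⟨p, hp, h, h'⟩ := h2
      exact ⟨p, hp, h.trans h1.1.symm, h1.2.trans_lt h'⟩
    · exact ⟨h1.1.trans h2.1, h1.2.trans h2.2⟩
  le_antisymm := by
    rintro (a | t) (b | v) h1 h2
    · exact congrArg Sum.inl (le_antisymm (α := α) h1 h2)
    · exact h1.elim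
    · exact h2.elim
    · exact congrArg Sum.inr (Subtype.ext (Prod.ext h1.1 (hi (le_antisymm h1.2 h2.2))))

theorem key_s5 {α ι : Type u} [PartialOrder α] [WellFoundedLT α] (h : AliOrder α)
    (g : α → ι) (r : α → Ordinal.{u}) (hm : StrictMono r) (hi : Function.Injective r)
    (hr : ∀ p, ∀ o < r p, ∃ q, r q = o) :
    ∃ f : α → ChainExt g r, (∀ a b, ExtLe g r (f a) (f b) ↔ a ≤ b) ∧
      ∀ x y, level α x = level α y →
        Sum.elim r (fun t => r t.1.2) (f x) = Sum.elim r (fun t => r t.1.2) (f y) := by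
  let _ := extOrder g r hi
  let ρ : ChainExt g r → Ordinal.{u} := Sum.elim r (fun t => r t.1.2)
  have h1 : StrictMono ρ := by
    intro z w hzw
    have hle : ExtLe g r z w := hzw.le
    have hne := hzw.ne
    rcases z with a | t <;> rcases w with b | v
    · exact hm (lt_of_le_of_ne hle (fun e => hne (congrArg _ e)))
    · exact hle.elim
    · obtain ⟨p, hp, _, h'⟩ := hle
      exact h'.trans_le (hm.monotone hp)
    · refine lt_of_le_of_ne hle.2 (fun e => hne ?_)
      exact congrArg Sum.inr (Subtype.ext (Prod.ext hle.1 (hi e)))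
  have h2 : ∀ z, ∀ o < ρ z, ∃ w, w < z ∧ ρ w = o := by
    rintro (p | t) o ho
    · obtain ⟨q, rfl⟩ := hr p o ho
      refine ⟨Sum.inr ⟨(g p, q), p, rfl, ho⟩, lt_of_le_of_ne ?_ (by simp), rfl⟩
      exact ⟨p, le_rfl, rfl, ho⟩
    · obtain ⟨q, rfl⟩ := hr t.1.2 o ho
      obtain ⟨p, hp, hp'⟩ := t.2
      have ho' : r q < r t.1.2 := ho
      refine ⟨Sum.inr ⟨(t.1.1, q), p, hp, ho'.trans hp'⟩, lt_of_le_of_ne ?_ ?_, rfl⟩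
      · exact ⟨rfl, ho'.le⟩
      · intro e
        exact ho.ne (congrArg ρ e)
  have : WellFoundedLT (ChainExt g r) := h1.wellFoundedLT
  obtain ⟨f, hf⟩ := h (ChainExt g r) ⟨⟨⟨Sum.inl, Sum.inl_injective⟩, Iff.rfl⟩⟩
  refine ⟨f, fun a b => f.le_iff_le, fun x y hxy => ?_⟩
  have := (hf x y).1 hxy
  rwa [level_eq_of ρ h1 h2, level_eq_of ρ h1 h2] at this

theorem level_strict {α : Type u} [PartialOrder α] [WellFoundedLT α] {x y : α} (h : x < y) :
    level α x < level α y := IsWellFounded.rank_lt_of_rel (r := (· < ·)) h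

theorem exists_below {α : Type u} [PartialOrder α] [WellFoundedLT α] {x : α}
    (h : level α x ≠ 0) : ∃ a, a < x := by
  by_contra! hc
  apply h
  unfold level
  rw [IsWellFounded.rank_eq]
  apply le_antisymm _ zero_le
  apply Ordinal.iSup_le
  rintro ⟨w, hw⟩
  exact (hc w hw).elim

/-- No ali order has a level of size 2 except possibly the first. -/
theorem stmt5 {α : Type u} [PartialOrder α] [WellFoundedLT α] (h : AliOrder α)
    {x y : α} (hxy : x ≠ y) (hl : level α x = level α y) :
    level α x = 0 := by
  by_contra h0
  obtain ⟨r, hm, hi, hr⟩ := exists_rk α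
  have nle : ∀ {x y : α}, x ≠ y → level α x = level α y → ¬ x ≤ y := fun hne hl hle =>
    (level_strict (lt_of_le_of_ne hle hne)).ne hl
  have hx := nle hxy hl
  have hy := nle hxy.symm hl.symm
  have hcommon : ∃ a, a ≤ x ∧ a ≤ y := by
    obtain ⟨f, hf, hlev⟩ := key_s5 h (fun _ => PUnit.unit.{u+1}) r hm hi hr
    have hlv := hlev x y hl
    have aux : ∀ x y : α, level α x ≠ 0 → ¬ x ≤ y → ∀ t z, f x = .inr t → f y = .inl z →
        r t.1.2 = r z → ∃ a, a ≤ x ∧ a ≤ y := by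
      intro x y h0 hx t z ex ey hlv
      obtain ⟨a, ha⟩ := exists_below h0
      have hax := (hf a x).2 ha.le
      have hxa := mt (hf x a).1 ha.not_ge
      refine ⟨a, ha.le, (hf a y).1 ?_⟩
      rw [ex] at hax hxa
      rw [ey]
      rcases ea : f a with b | v
      · rw [ea] at hax; exact hax.elim
      · rw [ea] at hax hxa
        refine ⟨z, le_rfl, rfl, hlv ▸ lt_of_not_ge fun hh => hxa ⟨rfl, hh⟩⟩
    have hfx := mt (hf x y).1 hx
    have hfy := mt (hf y x).1 hy
    rcases ex : f x with z | t <;> rcases ey : f y with w | v <;> rw [ex, ey] at hlv hfx hfy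
    · exact (hfx (hi hlv).le).elim
    · obtain ⟨a, h1, h2⟩ := aux y x (hl ▸ h0) hy v z ey ex hlv.symm
      exact ⟨a, h2, h1⟩
    · exact aux x y h0 hx t w ex ey hlv
    · exact (hfx ⟨rfl, le_of_eq hlv⟩).elim
  obtain ⟨a, hax, hay⟩ := hcommon
  obtain ⟨f, hf, hlev⟩ := key_s5 h (fun p : α => p) r hm hi hr
  have hlv := hlev x y hl
  have aux : ∀ x y : α, ¬ x ≤ y → a ≤ x → a ≤ y → ∀ t z, f x = .inr t → f y = .inl z →
      False := by
    intro x y hx hax hay t z ex ey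
    replace hax := (hf a x).2 hax
    replace hay := (hf a y).2 hay
    replace hx := mt (hf x y).1 hx
    rw [ex] at hax hx
    rw [ey] at hay hx
    rcases ea : f a with b | v
    · rw [ea] at hax; exact hax.elim
    · rw [ea] at hax hay
      obtain ⟨p, hp, e, _⟩ := hay
      obtain ⟨p', e', h'⟩ := t.2
      have hpp : p' = p := e'.trans (hax.1.symm.trans e.symm)
      exact hx ⟨p', hpp ▸ hp, e', h'⟩
  have hfx := mt (hf x y).1 hx
  have hfax := (hf a x).2 hax
  have hfay := (hf a y).2 hay
  rcases ex : f x with z | t <;> rcases ey : f y with w | v <;> rw [ex, ey] at hlv hfx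
  · exact hfx (hi hlv).le
  · exact aux y x hy hay hax v z ey ex
  · exact aux x y hx hax hay t w ex ey
  · rw [ex] at hfax
    rw [ey] at hfay
    rcases ea : f a with b | k
    · rw [ea] at hfax; exact hfax
    · rw [ea] at hfax hfay
      exact hfx ⟨hfax.1.symm.trans hfay.1, le_of_eq hlv⟩
end

section
/- The 3-element partial order consisting of a chain of height 2 and an incomparable element, i.e., {x, y, z} with x < y and z incomparable to both x and y, is an ali order. -/
universe u

theorem level_lt {α : Type u} [PartialOrder α] [WellFoundedLT α] {a b : α} (h : a < b) :
    level α a < level α b := IsWellFounded.rank_lt_of_rel h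

theorem exists_level {α : Type u} [PartialOrder α] [WellFoundedLT α] (o : Ordinal.{u}) (a : α) :
    o < level α a → ∃ b, b < a ∧ level α b = o := by
  induction a using WellFoundedLT.induction with
  | ind a ih =>
  intro h
  unfold level at h
  rw [IsWellFounded.rank_eq, Ordinal.lt_iSup_iff] at h
  obtain ⟨⟨b, hb⟩, h⟩ := h
  rcases (Order.lt_succ_iff.1 h).eq_or_lt with h | h
  · exact ⟨b, hb, h.symm⟩
  · obtain ⟨c, hc, e⟩ := ih b hb h
    exact ⟨c, hc.trans hb, e⟩

theorem exists_good {β : Type u} [PartialOrder β] [WellFoundedLT β] (a b c : β)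
    (hab : a < b) (hac : Incomp a c) (hbc : Incomp b c) :
    ∃ a b c : β, a < b ∧ Incomp a c ∧ Incomp b c ∧ level β a = level β c := by
  rcases lt_trichotomy (level β a) (level β c) with h | h | h
  · obtain ⟨d, hd, e⟩ := exists_level _ c h
    have had : Incomp a d := by
      refine ⟨fun h => hac.1 (h.trans hd.le), fun h => ?_⟩
      rcases h.eq_or_lt with h | h
      · exact hac.1 (h ▸ hd.le)
      · exact (level_lt h).ne e
    by_cases hdb : d ≤ b
    · exact ⟨d, c, a, hd, ⟨had.2, had.1⟩, ⟨hac.2, hac.1⟩, e⟩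
    · exact ⟨a, b, d, hab, had, ⟨fun h => hbc.1 (h.trans hd.le), hdb⟩, e.symm⟩
  · exact ⟨a, b, c, hab, hac, hbc, h⟩
  · obtain ⟨d, hd, e⟩ := exists_level _ a h
    refine ⟨d, b, c, hd.trans hab, ⟨fun h => ?_, fun h => hac.2 (h.trans hd.le)⟩, hbc, e⟩
    rcases h.eq_or_lt with h | h
    · exact hac.2 (h ▸ hd.le)
    · exact (level_lt h).ne e

/-- The 3-element order made of a chain of height 2 (`x < y`) and an element `z`
incomparable to both is an ali order. -/
theorem stmt8 (α : Type u) [PartialOrder α] [WellFoundedLT α]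
    (x y z : α) (hxy : x < y) (hxz : Incomp x z) (hyz : Incomp y z)
    (hcover : ∀ w : α, w = x ∨ w = y ∨ w = z) :
    AliOrder α := by
  intro β _ _ ⟨g⟩
  classical
  obtain ⟨a, b, c, hab, hac, hbc, hl⟩ := exists_good (g x) (g y) (g z) (g.lt_iff_lt.2 hxy)
    ⟨mt g.le_iff_le.1 hxz.1, mt g.le_iff_le.1 hxz.2⟩
    ⟨mt g.le_iff_le.1 hyz.1, mt g.le_iff_le.1 hyz.2⟩
  have hl1 : level α x < level α y := level_lt hxy
  have hl2 : level α x = level α z := by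
    rcases lt_trichotomy (level α x) (level α z) with h | h | h
    · obtain ⟨d, hd, -⟩ := exists_level _ z h
      rcases hcover d with rfl | rfl | rfl
      · exact absurd hd.le hxz.1
      · exact absurd hd.le hyz.1
      · exact absurd hd (lt_irrefl _)
    · exact h
    · obtain ⟨d, hd, -⟩ := exists_level _ x h
      rcases hcover d with rfl | rfl | rfl
      · exact absurd hd (lt_irrefl _)
      · exact absurd hd hxy.asymm
      · exact absurd hd.le hxz.2
  have hm1 : level β a < level β b := level_lt hab
  have hyx : y ≠ x := hxy.ne'
  have hzx : z ≠ x := fun h => hxz.1 h.ge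
  have hzy : z ≠ y := fun h => hyz.1 h.ge
  let f : α → β := fun w => if w = x then a else if w = y then b else c
  have fx : f x = a := by simp [f]
  have fy : f y = b := by simp [f, hyx]
  have fz : f z = c := by simp [f, hzx, hzy]
  have key : ∀ v w : α, f v ≤ f w ↔ v ≤ w := by
    intro v w
    rcases hcover v with hv | hv | hv <;> rcases hcover w with hw | hw | hw <;>
      rw [hv, hw] <;>
      simp [fx, fy, fz, hab.le, hab.not_ge, hxy.le, hxy.not_ge, hac.1, hac.2, hbc.1, hbc.2,
        hxz.1, hxz.2, hyz.1, hyz.2]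
  refine ⟨OrderEmbedding.ofMapLEIff f key, ?_⟩
  intro v w
  rw [OrderEmbedding.coe_ofMapLEIff]
  rcases hcover v with hv | hv | hv <;> rcases hcover w with hw | hw | hw <;>
    rw [hv, hw] <;>
    simp [fx, fy, fz, ← hl, ← hl2, hl1.ne, hl1.ne', hm1.ne, hm1.ne']
end

section
/- A finite partial order is an ali order if and only if it contains no induced suborder isomorphic to any of: O_obs1; O_obs2; the antichain of size 3 (three pairwise incomparable elements); or the 4-element partial order consisting of a chain a < b < c together with an element d incomparable to a, b, and c. -/
universe u

/-- `α` contains an induced suborder isomorphic to `O_obs1`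
(`a < b`, `c < d`, all other pairs incomparable). -/
def HasObs1 (α : Type u) [Preorder α] : Prop :=
  ∃ a b c d : α, a < b ∧ c < d ∧ Incomp a c ∧ Incomp a d ∧ Incomp b c ∧ Incomp b d

/-- `α` contains an induced suborder isomorphic to `O_obs2`
(`a < b`, `a < c`, `b` and `c` incomparable). -/
def HasObs2 (α : Type u) [Preorder α] : Prop :=
  ∃ a b c : α, a < b ∧ a < c ∧ Incomp b c

/-- `α` contains an induced suborder isomorphic to `O_obs3`
(`b < a`, `c < a`, `b` and `c` incomparable). -/
def HasObs3 (α : Type u) [Preorder α] : Prop :=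
  ∃ a b c : α, b < a ∧ c < a ∧ Incomp b c

/-- `α` contains an antichain of size 3. -/
def HasAntichain3 (α : Type u) [Preorder α] : Prop :=
  ∃ a b c : α, Incomp a b ∧ Incomp a c ∧ Incomp b c

/-- `α` contains a chain `a < b < c` together with an element `d` incomparable to all three. -/
def HasChain3PlusPoint (α : Type u) [Preorder α] : Prop :=
  ∃ a b c d : α, a < b ∧ b < c ∧ Incomp a d ∧ Incomp b d ∧ Incomp c d


namespace Ali

theorem level_lt {α : Type u} [PartialOrder α] [WellFoundedLT α] {x y : α} (h : x < y) :
    level α x < level α y := IsWellFounded.rank_lt_of_rel h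

theorem level_mono {α : Type u} [PartialOrder α] [WellFoundedLT α] {x y : α} (h : x ≤ y) :
    level α x ≤ level α y := by
  rcases h.eq_or_lt with h | h
  · rw [h]
  · exact (level_lt h).le

theorem exists_below {α : Type u} [PartialOrder α] [WellFoundedLT α] (x : α) :
    ∀ o < level α x, ∃ y < x, level α y = o := by
  induction x using WellFoundedLT.induction with
  | ind x ih =>
    intro o ho
    unfold level at ho
    rw [IsWellFounded.rank_eq, Ordinal.lt_iSup_iff] at ho
    obtain ⟨⟨y, hy⟩, h⟩ := ho
    have h' : o ≤ level α y := Order.lt_succ_iff.1 h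
    rcases h'.eq_or_lt with h' | h'
    · exact ⟨y, hy, h'.symm⟩
    · obtain ⟨z, hz, e⟩ := ih y hy o h'
      exact ⟨z, hz.trans hy, e⟩

theorem exists_below_le {α : Type u} [PartialOrder α] [WellFoundedLT α] (x : α)
    (o : Ordinal.{u}) (ho : o ≤ level α x) : ∃ y ≤ x, level α y = o := by
  rcases ho.eq_or_lt with h | h
  · exact ⟨x, le_rfl, h.symm⟩
  · obtain ⟨z, hz, e⟩ := exists_below x o h
    exact ⟨z, hz.le, e⟩

theorem level_le {α : Type u} [PartialOrder α] [WellFoundedLT α] (g : α → Ordinal.{u})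
    (hg : ∀ x y, x < y → g x < g y) (x : α) : level α x ≤ g x := by
  induction x using WellFoundedLT.induction with
  | ind x ih =>
    by_contra h
    push Not at h
    obtain ⟨y, hy, e⟩ := exists_below x _ h
    have := ih y hy
    rw [e] at this
    exact absurd (hg y x hy) (not_lt.2 this)

theorem li_lt {α β : Type u} [PartialOrder α] [WellFoundedLT α]
    [PartialOrder β] [WellFoundedLT β] {f : α ↪o β} (hf : LevelInduced f) {x y : α}
    (h : level α x < level α y) : level β (f x) < level β (f y) := by
  obtain ⟨z, hz, e⟩ := exists_below y _ h
  rw [← (hf z x).1 e]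
  exact level_lt (f.lt_iff_lt.2 hz)

theorem li_le {α β : Type u} [PartialOrder α] [WellFoundedLT α]
    [PartialOrder β] [WellFoundedLT β] {f : α ↪o β} (hf : LevelInduced f) {x y : α}
    (h : level α x ≤ level α y) : level β (f x) ≤ level β (f y) := by
  rcases h.eq_or_lt with h | h
  · exact ((hf x y).1 h).le
  · exact (li_lt hf h).le

theorem exists_N (α : Type u) [PartialOrder α] [Finite α] :
    ∃ N : α → ℕ, Function.Injective N ∧ ∀ x y, x < y → N x < N y := by
  classical
  have : Finite (LinearExtension α) := inferInstanceAs (Finite α)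
  have := Fintype.ofFinite (LinearExtension α)
  let e := Fintype.orderIsoFinOfCardEq (LinearExtension α) rfl |>.symm
  have inj : Function.Injective (fun x : α => ((e (toLinearExtension x)).val : ℕ)) := by
    intro x y h
    exact e.injective (Fin.ext h)
  refine ⟨_, inj, ?_⟩
  intro x y h
  refine lt_of_le_of_ne ?_ (fun h' => h.ne (inj h'))
  exact e.monotone (toLinearExtension.monotone h.le)

/-- extension of an order by a chain -/
inductive Ext (α C : Type u) (r : C → α → Prop) : Type u
  | old (x : α) : Ext α C r
  | new (c : C) : Ext α C r

class Mono {α C : Type u} [PartialOrder α] [LinearOrder C] (r : C → α → Prop) : Prop where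
  left : ∀ c d x, c ≤ d → r d x → r c x
  right : ∀ c x y, x ≤ y → r c x → r c y

section
variable {α C : Type u} [PartialOrder α] [LinearOrder C] {r : C → α → Prop}

def Ext.le : Ext α C r → Ext α C r → Prop
  | .old x, .old y => x ≤ y
  | .new c, .new d => c ≤ d
  | .new c, .old x => r c x
  | .old _, .new _ => False

instance [Mono r] : PartialOrder (Ext α C r) where
  le := Ext.le
  le_refl := by rintro (x | c) <;> simp [Ext.le]
  le_trans := by
    rintro (x | c) (y | d) (z | e) <;> simp only [Ext.le] <;> intro h1 h2 <;>
      try first | exact h1.elim | exact h2.elim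
    · exact h1.trans h2
    · exact Mono.right _ _ _ h2 h1
    · exact Mono.left _ _ _ h1 h2
    · exact h1.trans h2
  le_antisymm := by
    rintro (x | c) (y | d) <;> simp only [Ext.le] <;> intro h1 h2 <;>
      try first | exact h1.elim | exact h2.elim
    · rw [h1.antisymm h2]
    · rw [h1.antisymm h2]

variable [Mono r]

@[simp] theorem oo {x y : α} : (Ext.old x : Ext α C r) ≤ .old y ↔ x ≤ y := Iff.rfl
@[simp] theorem nn {x y : C} : (Ext.new x : Ext α C r) ≤ .new y ↔ x ≤ y := Iff.rfl
@[simp] theorem no {x : C} {y : α} : (Ext.new x : Ext α C r) ≤ .old y ↔ r x y := Iff.rfl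
@[simp] theorem on {x : α} {y : C} : (Ext.old x : Ext α C r) ≤ .new y ↔ False := Iff.rfl
@[simp] theorem oo' {x y : α} : (Ext.old x : Ext α C r) < .old y ↔ x < y := by
  simp [lt_iff_le_not_ge]
@[simp] theorem nn' {x y : C} : (Ext.new x : Ext α C r) < .new y ↔ x < y := by
  rw [lt_iff_le_not_ge, lt_iff_le_not_ge]; rfl
@[simp] theorem no' {x : C} {y : α} : (Ext.new x : Ext α C r) < .old y ↔ r x y := by
  simp [lt_iff_le_not_ge]
@[simp] theorem on' {x : α} {y : C} : ¬ (Ext.old x : Ext α C r) < .new y := by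
  simp [lt_iff_le_not_ge]

instance [WellFoundedLT α] [WellFoundedLT C] : WellFoundedLT (Ext α C r) where
  wf := by
    have h1 : ∀ c : C, Acc (· < ·) (Ext.new c : Ext α C r) := by
      intro c
      induction c using WellFoundedLT.induction with
      | ind c ih =>
        constructor
        rintro (x | d) h
        · exact absurd h on'
        · exact ih d (nn'.1 h)
    constructor
    rintro (x | c)
    · induction x using WellFoundedLT.induction with
      | ind c ih =>
        constructor
        rintro (x | d) h
        · exact ih x (oo'.1 h)
        · exact h1 d
    · exact h1 c

def emb (r : C → α → Prop) [Mono r] : α ↪o Ext α C r where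
  toFun := .old
  inj' := fun x y h => by cases h; rfl
  map_rel_iff' := Iff.rfl
end

theorem new_level {α : Type u} [PartialOrder α] [WellFoundedLT α] {r : ULift.{u} ℕ → α → Prop}
    [Mono r] (n : ℕ) : (n : Ordinal.{u}) ≤ level (Ext α (ULift.{u} ℕ) r) (.new ⟨n⟩) := by
  induction n with
  | zero => simp
  | succ n ih =>
    have : (Ext.new ⟨n⟩ : Ext α (ULift.{u} ℕ) r) < .new ⟨n+1⟩ := by
      rw [nn']; exact Nat.lt_succ_self n
    have := level_lt this
    push_cast
    rw [← Order.succ_eq_add_one]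
    exact Order.succ_le_of_lt (ih.trans_lt this)

/-- first step -/
theorem step1 {α : Type u} [PartialOrder α] [Finite α] (ha : AliOrder α) :
    ∃ K : α → Prop, (∀ x y, ¬ K x → ¬ K y → level α x = level α y → x = y) ∧
      (∀ x y, K x → K y → x ≤ y ∨ y ≤ x) ∧ (∀ x y, x ≤ y → K y → K x) ∧
      (∀ x y, K x → ¬ K y → level α x < level α y → x < y) := by
  obtain ⟨N, hN, hN'⟩ := exists_N α
  let r : ULift.{u} ℕ → α → Prop := fun c x => c.down < N x
  have : Mono r := ⟨fun c d x h h' => lt_of_le_of_lt (show c.down ≤ d.down from h) h',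
    fun c x y h h' => by
      rcases h.eq_or_lt with h | h
      · subst h; exact h'
      · exact lt_trans h' (hN' _ _ h)⟩
  let β := Ext α (ULift.{u} ℕ) r
  obtain ⟨f, hf⟩ := ha β ⟨emb r⟩
  let g : β → Ordinal.{u} := fun x => match x with
    | .old x => (N x : Ordinal.{u})
    | .new c => (c.down : Ordinal.{u})
  have hg : ∀ x y, x < y → g x < g y := by
    rintro (x | c) (y | d) h
    · exact Nat.cast_lt.2 (hN' _ _ (oo'.1 h))
    · exact absurd h on'
    · exact Nat.cast_lt.2 ((no' (r := r)).1 h)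
    · exact Nat.cast_lt.2 ((nn' (r := r)).1 h)
  have hle := level_le g hg
  have hnew : ∀ n : ULift.{u} ℕ, level β (.new n) = (n.down : Ordinal.{u}) := fun n =>
    le_antisymm (hle _) (new_level n.down)
  have hold : ∀ x : α, level β (.old x) = (N x : Ordinal.{u}) := fun x => by
    refine le_antisymm (hle _) ?_
    rcases hn : N x with _ | m
    · simp
    · have : (Ext.new ⟨m⟩ : β) < .old x := no'.2 (show m < N x by omega)
      have := level_lt this
      push_cast
      rw [← Order.succ_eq_add_one]
      exact Order.succ_le_of_lt ((new_level (r := r) m).trans_lt this)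
  refine ⟨fun x => ∃ c, f x = .new c, ?_, ?_, ?_, ?_⟩
  · intro x y hx hy h
    have h := (hf x y).1 h
    rcases ex : f x with x' | c
    · rcases ey : f y with y' | c
      · rw [ex, ey, hold, hold] at h
        have := hN (Nat.cast_injective h)
        subst this
        exact f.injective (ex.trans ey.symm)
      · exact absurd ⟨c, ey⟩ hy
    · exact absurd ⟨c, ex⟩ hx
  · rintro x y ⟨c, hc⟩ ⟨d, hd⟩
    rw [← f.le_iff_le, ← f.le_iff_le, hc, hd]
    exact le_total c d
  · rintro x y h ⟨c, hc⟩
    rw [← f.le_iff_le, hc] at h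
    rcases ex : f x with x' | d
    · rw [ex] at h; exact absurd h on.1
    · exact ⟨d, rfl⟩
  · rintro x y ⟨c, hc⟩ hy h
    have h := li_lt hf h
    rcases ey : f y with y' | d
    · rw [hc, ey, hnew, hold] at h
      rw [← f.lt_iff_lt, hc, ey]
      exact no'.2 (Nat.cast_lt.1 h)
    · exact absurd ⟨d, ey⟩ hy

theorem surj_of_inj {α : Type u} [Finite α] (T : α → Prop) (φ : α → α)
    (h1 : ∀ x, T x → T (φ x)) (h2 : ∀ x y, T x → T y → φ x = φ y → x = y) :
    ∀ y, T y → ∃ x, T x ∧ φ x = y := by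
  let ψ : {x // T x} → {x // T x} := fun x => ⟨φ x, h1 x x.2⟩
  have hi : Function.Injective ψ := by
    rintro ⟨x, hx⟩ ⟨y, hy⟩ h
    exact Subtype.ext (h2 x y hx hy (congrArg Subtype.val h))
  intro y hy
  obtain ⟨x, hx⟩ := (Finite.injective_iff_surjective.1 hi) ⟨y, hy⟩
  exact ⟨x, x.2, congrArg Subtype.val hx⟩

/-- the case of two incomparable elements of the same positive level -/
theorem step2 {α : Type u} [PartialOrder α] [Finite α] (ha : AliOrder α) (a p q : α)
    (hl : level α p = level α q) (hpq : p ≠ q) (hap : a < p) (haq : a < q)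
    (hup : ∀ x, level α p < level α x → p < x)
    (hch : ∀ x y, level α p < level α x → level α p < level α y → x ≤ y ∨ y ≤ x) : False := by
  obtain ⟨N, hN, hN'⟩ := exists_N α
  let r : ULift.{u} ℕ → α → Prop := fun c x => p ≤ x
  have : Mono r := ⟨fun c d x h h' => h', fun c x y h h' => le_trans h' h⟩
  let β := Ext α (ULift.{u} ℕ) r
  obtain ⟨f, hf⟩ := ha β ⟨emb r⟩
  have inc : Incomp p q := by
    constructor
    · intro h
      exact (level_lt (lt_of_le_of_ne h hpq)).ne hl
    · intro h
      exact (level_lt (lt_of_le_of_ne h hpq.symm)).ne hl.symm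
  have chU : ∀ x y, p ≤ x → p ≤ y → x ≤ y ∨ y ≤ x := by
    intro x y hx hy
    rcases hx.eq_or_lt with rfl | hx
    · exact Or.inl hy
    rcases hy.eq_or_lt with rfl | hy
    · exact Or.inr hx.le
    exact hch x y (level_lt hx) (level_lt hy)
  classical
  let g : β → Ordinal.{u} := fun x => match x with
    | .old x => if p ≤ x then Ordinal.omega0 + (N x : Ordinal.{u}) else (N x : Ordinal.{u})
    | .new c => (c.down : Ordinal.{u})
  have hg : ∀ x y, x < y → g x < g y := by
    rintro (x | c) (y | d) h
    · have h := oo'.1 h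
      have h' : (N x : Ordinal.{u}) < N y := Nat.cast_lt.2 (hN' _ _ h)
      by_cases hx : p ≤ x
      · have hy : p ≤ y := hx.trans h.le
        simp only [g, hx, hy, if_true]
        exact (add_lt_add_iff_left _).2 h'
      · by_cases hy : p ≤ y
        · simp only [g, hx, hy, if_true, if_false]
          exact (Ordinal.natCast_lt_omega0 _).trans_le le_self_add
        · simp only [g, hx, hy, if_false]
          exact h'
    · exact absurd h on'
    · have h : p ≤ y := (no' (r := r)).1 h
      simp only [g, h, if_true]
      exact (Ordinal.natCast_lt_omega0 _).trans_le le_self_add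
    · exact Nat.cast_lt.2 ((nn' (r := r)).1 h)
  have hle := level_le g hg
  have hU : ∀ x, p ≤ x → Ordinal.omega0 ≤ level β (.old x) := by
    intro x hx
    rw [Ordinal.omega0_le]
    intro n
    exact (new_level (r := r) n).trans (level_lt ((no' (r := r)).2 hx)).le
  have hD : ∀ z : β, Ordinal.omega0 ≤ level β z → ∃ x, z = .old x ∧ p ≤ x := by
    rintro (x | c) h
    · refine ⟨x, rfl, ?_⟩
      by_contra hx
      have := h.trans (hle _)
      simp only [g, hx, if_false] at this
      exact absurd (Ordinal.natCast_lt_omega0 _) (not_lt.2 this)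
    · have := h.trans (hle _)
      exact absurd (Ordinal.natCast_lt_omega0 _) (not_lt.2 this)
  let W : α → Prop := fun w => ∃ b c, w < b ∧ w < c ∧ Incomp b c
  let T : α → Prop := fun x => ∃ w, w ≤ x ∧ W w
  have old_of_le : ∀ (x : α) (z : β), (.old x : β) ≤ z → ∃ y, z = .old y := by
    rintro x (y | c) h
    · exact ⟨y, rfl⟩
    · exact absurd h on.1
  have hW : ∀ w, W w → ∃ v, f w = .old v ∧ W v := by
    rintro w ⟨b, c, hb, hc, h1, h2⟩
    rw [← f.lt_iff_lt] at hb hc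
    rw [← f.le_iff_le] at h1 h2
    rcases ew : f w with v | n
    · refine ⟨v, rfl, ?_⟩
      rw [ew] at hb hc
      obtain ⟨b', eb⟩ := old_of_le _ _ hb.le
      obtain ⟨c', ec⟩ := old_of_le _ _ hc.le
      rw [eb] at hb h1 h2
      rw [ec] at hc h1 h2
      exact ⟨b', c', oo'.1 hb, oo'.1 hc, h1, h2⟩
    · exfalso
      rw [ew] at hb hc
      rcases eb : f b with b' | b' <;> rcases ec : f c with c' | c' <;>
        rw [eb] at hb h1 h2 <;> rw [ec] at hc h1 h2
      · rcases chU b' c' ((no' (r := r)).1 hb) ((no' (r := r)).1 hc) with h | h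
        · exact h1 h
        · exact h2 h
      · exact h2 ((no' (r := r)).1 hb)
      · exact h1 ((no' (r := r)).1 hc)
      · rcases le_total b' c' with h | h
        · exact h1 h
        · exact h2 h
  let φ : α → α := fun x => match f x with
    | .old y => y
    | .new _ => p
  have hφ : ∀ x y, f x = .old y → φ x = y := by
    intro x y h
    simp only [φ, h]
  have hT : ∀ x, T x → f x = .old (φ x) ∧ T (φ x) := by
    rintro x ⟨w, hw, hww⟩
    obtain ⟨v, ev, hv⟩ := hW w hww
    rw [← f.le_iff_le, ev] at hw
    obtain ⟨y, ey⟩ := old_of_le _ _ hw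
    rw [hφ x y ey]
    rw [ey] at hw
    exact ⟨ey, v, hw, hv⟩
  have hsurj := surj_of_inj T φ (fun x hx => (hT x hx).2) (by
    intro x y hx hy h
    apply f.injective
    rw [(hT x hx).1, (hT y hy).1, h])
  have hTU : ∀ x, p ≤ x → T x := fun x hx => ⟨a, hap.le.trans hx, p, q, hap, haq, inc⟩
  obtain ⟨p', hp', ep'⟩ := hsurj p (hTU p le_rfl)
  have efp : f p' = .old p := by rw [(hT p' hp').1, ep']
  have hlev : level α p < level α p' := by
    by_contra h
    push Not at h
    have h1 := li_le hf h
    have h2 := li_le hf (h.trans hl.le)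
    rw [efp] at h1 h2
    obtain ⟨x, ex, hx⟩ := hD _ ((hU p le_rfl).trans h1)
    obtain ⟨y, ey, hy⟩ := hD _ ((hU p le_rfl).trans h2)
    rcases chU x y hx hy with h | h
    · refine inc.1 (f.le_iff_le.1 ?_)
      rw [ex, ey]; exact h
    · refine inc.2 (f.le_iff_le.1 ?_)
      rw [ex, ey]; exact h
  have hsub : {x | p ≤ x} ⊆ φ '' {x | p < x} := by
    intro u hu
    obtain ⟨u', hu', eu'⟩ := hsurj u (hTU u hu)
    refine ⟨u', ?_, eu'⟩
    have : p' ≤ u' := by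
      rw [← f.le_iff_le, efp, (hT u' hu').1, eu']
      exact hu
    exact hup _ (hlev.trans_le (level_mono this))
  have h1 := Set.ncard_le_ncard hsub (Set.toFinite _)
  have h2 := Set.ncard_image_le (f := φ) (Set.toFinite {x | p < x})
  have h3 : Set.ncard {x | p < x} < Set.ncard {x | p ≤ x} := by
    apply Set.ncard_lt_ncard _ (Set.toFinite _)
    refine ⟨fun x hx => le_of_lt hx, fun h => ?_⟩
    exact lt_irrefl p (h (show p ≤ p from le_rfl))
  omega

/-- combination of the first two steps -/
theorem step12 {α : Type u} [PartialOrder α] [Finite α] (ha : AliOrder α) :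
    ∃ y0 : α → Prop, (∀ x y, y0 x → y0 y → x = y) ∧ (∀ x, y0 x → level α x = 0) ∧
      ∀ x y, Incomp x y → y0 x ∨ y0 y := by
  obtain ⟨K, k1, k2, k3, k4⟩ := step1 ha
  have key : ∀ y k, ¬ K y → K k → level α k = level α y → level α y = 0 := by
    by_contra hne
    push Not at hne
    let S : Set α := {y | ¬ K y ∧ ∃ k, K k ∧ level α k = level α y ∧ level α y ≠ 0}
    have hS : S.Nonempty := by
      obtain ⟨y, k, h1, h2, h3, h4⟩ := hne
      exact ⟨y, h1, k, h2, h3, h4⟩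
    obtain ⟨y, ⟨hy, k, hk, hky, hy0⟩, hmax⟩ := Set.exists_max_image S (level α) (Set.toFinite _) hS
    have hpos : 0 < level α k := by rw [hky]; exact pos_iff_ne_zero.2 hy0
    obtain ⟨a, hak, ea⟩ := exists_below k 0 hpos
    have hKa := k3 _ _ hak.le hk
    have hay : a < y := k4 _ _ hKa hy (by rw [ea, ← hky]; exact hpos)
    have hne' : k ≠ y := fun h => hy (h ▸ hk)
    have huniq : ∀ x x', level α k < level α x → level α x = level α x' → x = x' := by
      intro x x' hx hxx
      have aux : ∀ x x', level α k < level α x → level α x = level α x' → K x → ¬ K x' → False := by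
        intro x x' hx hxx h1 h2
        have : x' ∈ S := ⟨h2, x, h1, hxx, by
          rw [← hxx]; exact (hpos.trans hx).ne'⟩
        have := hmax _ this
        rw [← hxx, ← hky] at this
        exact absurd hx (not_lt.2 this)
      by_cases h1 : K x <;> by_cases h2 : K x'
      · rcases k2 _ _ h1 h2 with h | h
        · by_contra hn
          exact (level_lt (lt_of_le_of_ne h hn)).ne hxx
        · by_contra hn
          exact (level_lt (lt_of_le_of_ne h (Ne.symm hn))).ne hxx.symm
      · exact (aux x x' hx hxx h1 h2).elim
      · exact (aux x' x (hxx ▸ hx) hxx.symm h2 h1).elim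
      · exact k1 _ _ h1 h2 hxx
    have hlele : ∀ x x', level α k < level α x → level α x ≤ level α x' → x ≤ x' := by
      intro x x' hx h
      obtain ⟨x'', h1, h2⟩ := exists_below_le x' _ h
      rw [huniq x x'' hx h2.symm]
      exact h1
    have hch : ∀ x x', level α k < level α x → level α k < level α x' → x ≤ x' ∨ x' ≤ x := by
      intro x x' hx hx'
      rcases le_total (level α x) (level α x') with h | h
      · exact Or.inl (hlele _ _ hx h)
      · exact Or.inr (hlele _ _ hx' h)
    let Z : Set α := {x | level α k < level α x}
    rcases Z.eq_empty_or_nonempty with hZ | hZ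
    · refine step2 ha a k y hky hne' hak hay ?_ hch
      intro x hx
      have : x ∈ Z := hx
      rw [hZ] at this
      exact this.elim
    · obtain ⟨z, hz, hmin⟩ := Set.exists_min_image Z (level α) (Set.toFinite _) hZ
      obtain ⟨p, hpz, ep⟩ := exists_below z _ hz
      have hup : ∀ x, level α k < level α x → p < x := by
        intro x hx
        exact hpz.trans_le (hlele z x hz (hmin x hx))
      by_cases hp : K p
      · have : p = k := by
          rcases k2 _ _ hp hk with h | h
          · by_contra hn
            exact (level_lt (lt_of_le_of_ne h hn)).ne ep
          · by_contra hn
            exact (level_lt (lt_of_le_of_ne h (Ne.symm hn))).ne ep.symm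
        subst this
        exact step2 ha a p y hky hne' hak hay hup hch
      · have : p = y := k1 _ _ hp hy (ep.trans hky)
        subst this
        rw [hky] at hup hch
        exact step2 ha a p k hky.symm hne'.symm hay hak hup hch
  refine ⟨fun x => ¬ K x ∧ level α x = 0, ?_, fun x h => h.2, ?_⟩
  · intro x y hx hy
    exact k1 _ _ hx.1 hy.1 (hx.2.trans hy.2.symm)
  · have A : ∀ x y, Incomp x y → K x → ¬ K y → level α y = 0 := by
      intro x y h hx hy
      have : level α y ≤ level α x := by
        by_contra hn
        exact h.1 (k4 _ _ hx hy (not_le.1 hn)).le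
      obtain ⟨x', h1, h2⟩ := exists_below_le x _ this
      exact key y x' hy (k3 _ _ h1 hx) h2
    have B : ∀ x y, Incomp x y → ¬ K x → ¬ K y → level α x < level α y → level α x = 0 := by
      intro x y h hx hy hl
      obtain ⟨x', h1, h2⟩ := exists_below y _ hl
      by_cases hk : K x'
      · exact key x x' hx hk h2
      · have := k1 _ _ hk hx h2
        subst this
        exact absurd h1.le h.1
    intro x y h
    by_cases hx : K x <;> by_cases hy : K y
    · rcases k2 _ _ hx hy with h' | h'
      · exact absurd h' h.1
      · exact absurd h' h.2
    · exact Or.inr ⟨hy, A x y h hx hy⟩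
    · exact Or.inl ⟨hx, A y x ⟨h.2, h.1⟩ hy hx⟩
    · rcases lt_trichotomy (level α x) (level α y) with h' | h' | h'
      · exact Or.inl ⟨hx, B x y h hx hy h'⟩
      · exact absurd (k1 _ _ hx hy h').le h.1
      · exact Or.inr ⟨hy, B y x ⟨h.2, h.1⟩ hy hx h'⟩

theorem struct {α : Type u} [PartialOrder α] (h1 : ¬ HasObs1 α) (h2 : ¬ HasObs2 α)
    (h3 : ¬ HasAntichain3 α) {k l d : α} (hkl : k < l) (hk : Incomp k d) (hl : Incomp l d) :
    (∀ x y, Incomp x d → Incomp y d → x ≤ y ∨ y ≤ x) ∧ (∀ e, ¬ e < d) ∧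
    (∀ e x, d < e → Incomp x d → x < e) := by
  have hch : ∀ x y, Incomp x d → Incomp y d → x ≤ y ∨ y ≤ x := by
    intro x y hx hy
    by_contra h
    push Not at h
    exact h3 ⟨x, y, d, ⟨h.1, h.2⟩, hx, hy⟩
  have hV : ∀ a b c : α, a < b → a < c → b ≤ c ∨ c ≤ b := by
    intro a b c hb hc
    by_contra h
    push Not at h
    exact h2 ⟨a, b, c, hb, hc, h⟩
  refine ⟨hch, ?_, ?_⟩
  · intro e he
    have aux : ∀ x, Incomp x d → Incomp e x := by
      intro x hx
      constructor
      · intro h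
        rcases h.eq_or_lt with rfl | h
        · exact hx.1 he.le
        · rcases hV _ _ _ h he with h' | h'
          · exact hx.1 h'
          · exact hx.2 h'
      · intro h
        exact hx.1 (h.trans he.le)
    exact h1 ⟨e, d, k, l, he, hkl, aux k hk, aux l hl, hk.symm, hl.symm⟩
  · have aux : ∀ e lo hi, d < e → lo < hi → Incomp lo d → Incomp hi d → lo < e ∧ hi < e := by
      intro e lo hi he hlh hlo hhi
      have n1 : ¬ e ≤ lo := fun h => hlo.2 (he.le.trans h)
      have n2 : ¬ e ≤ hi := fun h => hhi.2 (he.le.trans h)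
      have hlt : lo < e := by
        by_contra h
        have hne : lo ≠ e := fun h => n1 h.ge
        have hle : ¬ lo ≤ e := fun h' => h (lt_of_le_of_ne h' hne)
        exact h1 ⟨d, e, lo, hi, he, hlh, hlo.symm, hhi.symm, ⟨n1, hle⟩,
          ⟨n2, fun h => hle (hlh.le.trans h)⟩⟩
      refine ⟨hlt, ?_⟩
      rcases hV _ _ _ hlt hlh with h | h
      · exact absurd h n2
      · exact lt_of_le_not_ge h n2
    intro e x he hx
    by_cases hxk : x = k
    · subst hxk; exact (aux e _ _ he hkl hk hl).1
    · rcases hch x k hx hk with h | h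
      · exact (aux e _ _ he (lt_of_le_of_ne h hxk) hx hk).1
      · exact (aux e _ _ he (lt_of_le_of_ne h (Ne.symm hxk)) hk hx).2

theorem step3 {α : Type u} [PartialOrder α] [Finite α] (ha : AliOrder α)
    (h1 : ¬ HasObs1 α) (h2 : ¬ HasObs2 α)
    (h3 : ¬ HasAntichain3 α) : ¬ HasChain3PlusPoint α := by
  rintro ⟨a, b, c, d, hab, hbc, had, hbd, hcd⟩
  obtain ⟨hch, hdmin, hZ⟩ := struct h1 h2 h3 hab had hbd
  obtain ⟨k0, hk0, hk0'⟩ := (wellFounded_lt (α := α)).has_min {x | Incomp x d} ⟨a, had⟩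
  have m0 : ∀ x, Incomp x d → k0 ≤ x := by
    intro x hx
    rcases hch k0 x hk0 hx with h | h
    · exact h
    · rcases h.eq_or_lt with h | h
      · exact h.ge
      · exact absurd h (hk0' x hx)
  obtain ⟨k1, hk1, hk1'⟩ := (wellFounded_lt (α := α)).has_min {x | Incomp x d ∧ k0 < x}
    ⟨b, hbd, (m0 a had).trans_lt hab⟩
  have m1 : ∀ x, Incomp x d → k0 < x → k1 ≤ x := by
    intro x hx hx0
    rcases hch k1 x hk1.1 hx with h | h
    · exact h
    · rcases h.eq_or_lt with h | h
      · exact h.ge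
      · exact absurd h (hk1' x ⟨hx, hx0⟩)
  have m2 : ∀ x, Incomp x d → x = k0 ∨ x = k1 ∨ k1 < x := by
    intro x hx
    rcases (m0 x hx).eq_or_lt with h | h
    · exact Or.inl h.symm
    · rcases (m1 x hx h).eq_or_lt with h | h
      · exact Or.inr (Or.inl h.symm)
      · exact Or.inr (Or.inr h)
  have tri : ∀ z, z = d ∨ Incomp z d ∨ d < z := by
    intro z
    by_cases hz : z ≤ d
    · rcases hz.eq_or_lt with h | h
      · exact Or.inl h
      · exact absurd h (hdmin z)
    · by_cases hz' : d ≤ z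
      · exact Or.inr (Or.inr (lt_of_le_not_ge hz' hz))
      · exact Or.inr (Or.inl ⟨hz, hz'⟩)
  have k0min : ∀ e, ¬ e < k0 := by
    intro e he
    rcases tri e with h | h | h
    · subst h; exact hk0.2 he.le
    · exact hk0' e h he
    · exact hk0.2 (h.trans he).le
  let r : PUnit.{u+1} → α → Prop := fun _ x => d ≤ x ∨ k1 < x
  have : Mono r := ⟨fun c d x h h' => h', fun c x y h h' =>
    h'.imp (fun h' => h'.trans h) (fun h' => h'.trans_le h)⟩
  let β := Ext α PUnit.{u+1} r
  obtain ⟨f, hf⟩ := ha β ⟨emb r⟩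
  have hfi : ∀ x, Incomp x d → ¬ f x ≤ f d ∧ ¬ f d ≤ f x := by
    intro x hx
    rw [f.le_iff_le, f.le_iff_le]; exact hx
  have two : ∀ u v : β, (∀ x, Incomp x d → f x = u ∨ f x = v) → False := by
    intro u v h
    have n1 : f a ≠ f b := fun h => hab.ne (f.injective h)
    have n2 : f b ≠ f c := fun h => hbc.ne (f.injective h)
    have n3 : f a ≠ f c := fun h => (hab.trans hbc).ne (f.injective h)
    have := h a had
    have := h b hbd
    have := h c hcd
    grind
  have fd : f d = .old d := by
    rcases ed : f d with y | n
    · rcases tri y with h | h | h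
      · rw [h]
      · exfalso
        apply two (.old d) (.new PUnit.unit)
        intro x hx
        have hx' := hfi x hx
        rw [ed] at hx'
        rcases ex : f x with z | n
        · left
          rw [ex] at hx'
          have hz : ¬ z ≤ y ∧ ¬ y ≤ z := hx'
          rcases tri z with h' | h' | h'
          · rw [h']
          · rcases hch z y h' h with h'' | h''
            · exact absurd h'' hz.1
            · exact absurd h'' hz.2
          · exact absurd (hZ z y h' h).le hz.2
        · right; rfl
      · exfalso
        have hx' := hfi a had
        rw [ed] at hx'
        rcases ex : f a with z | n
        · rw [ex] at hx'
          have hz : ¬ z ≤ y ∧ ¬ y ≤ z := hx'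
          rcases tri z with h' | h' | h'
          · rw [h'] at hz; exact hz.1 h.le
          · exact hz.1 (hZ y z h h').le
          · have w1 := hZ z k0 h' hk0
            have w2 := hZ y k0 h hk0
            exact h2 ⟨k0, z, y, w1, w2, hz⟩
        · rw [ex] at hx'
          exact hx'.1 ((no (r := r)).2 (Or.inl h.le))
    · exfalso
      apply two (.old k0) (.old k1)
      intro x hx
      have hx' := hfi x hx
      rw [ed] at hx'
      rcases ex : f x with z | m
      · rw [ex] at hx'
        have hz : ¬ (d ≤ z ∨ k1 < z) := hx'.2
        push Not at hz
        rcases tri z with h | h | h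
        · exact absurd h.ge hz.1
        · rcases m2 z h with h | h | h
          · left; rw [h]
          · right; rw [h]
          · exact absurd h hz.2
        · exact absurd h.le hz.1
      · rw [ex] at hx'
        exact absurd ((nn (r := r)).2 (le_refl n)) hx'.1
  have fX : ∀ x, Incomp x d → ∃ y, f x = .old y ∧ Incomp y d := by
    intro x hx
    have hx' := hfi x hx
    rw [fd] at hx'
    rcases ex : f x with z | n
    · rw [ex] at hx'
      exact ⟨z, rfl, hx'⟩
    · rw [ex] at hx'
      exact absurd ((no (r := r)).2 (Or.inl le_rfl)) hx'.1
  let φ : α → α := fun x => match f x with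
    | .old y => y
    | .new _ => d
  have hφ : ∀ x y, f x = .old y → φ x = y := by
    intro x y h
    simp only [φ, h]
  have hT : ∀ x, Incomp x d → f x = .old (φ x) ∧ Incomp (φ x) d := by
    intro x hx
    obtain ⟨y, ey, hy⟩ := fX x hx
    rw [hφ x y ey]
    exact ⟨ey, hy⟩
  obtain ⟨k', hk', ek'⟩ := surj_of_inj (fun x => Incomp x d) φ (fun x hx => (hT x hx).2) (by
    intro x y hx hy h
    apply f.injective
    rw [(hT x hx).1, (hT y hy).1, h]) k0 hk0
  have fk0 : f k0 = .old k0 := by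
    have hle := f.le_iff_le.2 (m0 k' hk')
    rw [(hT k' hk').1, (hT k0 hk0).1, ek'] at hle
    have hle : φ k0 ≤ k0 := hle
    rw [(hT k0 hk0).1, hle.antisymm (m0 _ (hT k0 hk0).2)]
  have lev0 : ∀ (γ : Type u) [PartialOrder γ] [WellFoundedLT γ] (x : γ), (∀ e, ¬ e < x) →
      level γ x = 0 := by
    intro γ _ _ x hx
    by_contra h
    obtain ⟨y, hy, _⟩ := exists_below x 0 (pos_iff_ne_zero.2 h)
    exact hx y hy
  have e1 : level α k0 = level α d := by rw [lev0 α k0 k0min, lev0 α d hdmin]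
  have e2 := (hf _ _).1 e1
  rw [fd, fk0, lev0 β (.old k0)] at e2
  · have : (Ext.new PUnit.unit : β) < .old d := (no' (r := r)).2 (Or.inl le_rfl)
    have := level_lt this
    rw [← e2] at this
    exact absurd this not_lt_zero
  · rintro (y | n) h
    · exact k0min y (oo'.1 h)
    · rcases (no' (r := r)).1 h with h | h
      · exact hk0.2 h
      · exact lt_asymm hk1.2 h

theorem forward {α : Type u} [PartialOrder α] [Finite α] (ha : AliOrder α) :
    ¬ HasObs1 α ∧ ¬ HasObs2 α ∧ ¬ HasAntichain3 α ∧ ¬ HasChain3PlusPoint α := by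
  obtain ⟨y0, p1, p2, p3⟩ := step12 ha
  have h1 : ¬ HasObs1 α := by
    rintro ⟨a, b, c, d, hab, hcd, hac, had, hbc, hbd⟩
    have q1 : a ≠ b := hab.ne
    have q2 : c ≠ d := hcd.ne
    have q3 : a ≠ d := fun h => had.1 h.le
    have q4 : b ≠ c := fun h => hbc.1 h.le
    rcases p3 _ _ hac with h | h <;> rcases p3 _ _ hbd with h' | h'
    · exact q1 (p1 _ _ h h')
    · exact q3 (p1 _ _ h h')
    · exact q4 (p1 _ _ h' h)
    · exact q2 (p1 _ _ h h')
  have h2 : ¬ HasObs2 α := by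
    rintro ⟨a, b, c, hab, hac, hbc⟩
    rcases p3 _ _ hbc with h | h
    · have := level_lt hab
      rw [p2 _ h] at this
      exact absurd this not_lt_zero
    · have := level_lt hac
      rw [p2 _ h] at this
      exact absurd this not_lt_zero
  have h3 : ¬ HasAntichain3 α := by
    rintro ⟨a, b, c, hab, hac, hbc⟩
    have q1 : a ≠ b := fun h => hab.1 h.le
    have q2 : a ≠ c := fun h => hac.1 h.le
    have q3 : b ≠ c := fun h => hbc.1 h.le
    rcases p3 _ _ hab with h | h
    · rcases p3 _ _ hbc with h' | h'
      · exact q1 (p1 _ _ h h')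
      · exact q2 (p1 _ _ h h')
    · rcases p3 _ _ hac with h' | h'
      · exact q1 (p1 _ _ h' h)
      · exact q3 (p1 _ _ h h')
  exact ⟨h1, h2, h3, step3 ha h1 h2 h3⟩

theorem li_of {α β : Type u} [PartialOrder α] [WellFoundedLT α]
    [PartialOrder β] [WellFoundedLT β] (g : α ↪o β) (x y : α) (h1 : level α x = level α y)
    (h2 : level β (g x) = level β (g y))
    (h : ∀ u v, Incomp u v → (x ≤ u ∧ v = y) ∨ (x ≤ v ∧ u = y)) : LevelInduced g := by
  have lt : ∀ u v, u < v → (level α u = level α v ↔ level β (g u) = level β (g v)) := by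
    intro u v huv
    exact iff_of_false (level_lt huv).ne (level_lt (g.lt_iff_lt.2 huv)).ne
  have aux : ∀ u, x ≤ u → (level α u = level α y ↔ level β (g u) = level β (g y)) := by
    intro u hu
    rcases hu.eq_or_lt with rfl | hu
    · exact iff_of_true h1 h2
    · rw [← h1, ← h2, eq_comm, @eq_comm _ (level β (g u))]
      exact lt x u hu
  intro u v
  by_cases huv : u ≤ v
  · rcases huv.eq_or_lt with rfl | huv
    · simp
    · exact lt u v huv
  by_cases hvu : v ≤ u
  · rw [eq_comm, @eq_comm _ (level β (g u))]
    rcases hvu.eq_or_lt with rfl | hvu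
    · simp
    · exact lt v u hvu
  rcases h u v ⟨huv, hvu⟩ with ⟨h', rfl⟩ | ⟨h', rfl⟩
  · exact aux u h'
  · rw [eq_comm, @eq_comm _ (level β (g u))]
    exact aux v h'

theorem lev0 {γ : Type u} [PartialOrder γ] [WellFoundedLT γ] {x : γ} (hx : ∀ e, ¬ e < x) :
    level γ x = 0 := by
  by_contra h
  obtain ⟨y, hy, _⟩ := exists_below x 0 (pos_iff_ne_zero.2 h)
  exact hx y hy

theorem inc_of_level {γ : Type u} [PartialOrder γ] [WellFoundedLT γ] {x y : γ}
    (h : level γ x = level γ y) (hne : x ≠ y) : Incomp x y :=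
  ⟨fun h' => (level_lt (lt_of_le_of_ne h' hne)).ne h,
    fun h' => (level_lt (lt_of_le_of_ne h' hne.symm)).ne h.symm⟩

theorem case1 {α β : Type u} [PartialOrder α] [WellFoundedLT α]
    [PartialOrder β] [WellFoundedLT β] (f : α ↪o β) (x y : α) (hxy : Incomp x y)
    (hw : ∀ w, w ≠ x → w ≠ y → x < w ∧ y < w)
    (ht : ∀ u v, Incomp u v → (x ≤ u ∧ v = y) ∨ (x ≤ v ∧ u = y))
    (hl : level α x = level α y) : ∃ g : α ↪o β, LevelInduced g := by
  classical
  have hne : x ≠ y := fun h => hxy.1 h.le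
  obtain ⟨X, Y, hX, hY, hl', hXY⟩ : ∃ X Y, X ≤ f x ∧ Y ≤ f y ∧ level β X = level β Y ∧ X ≠ Y := by
    have n1 : ¬ f x ≤ f y := fun h => hxy.1 (f.le_iff_le.1 h)
    have n2 : ¬ f y ≤ f x := fun h => hxy.2 (f.le_iff_le.1 h)
    rcases le_total (level β (f x)) (level β (f y)) with h | h
    · obtain ⟨Y, h1, h2⟩ := exists_below_le _ _ h
      exact ⟨f x, Y, le_rfl, h1, h2.symm, fun h => n1 (h.le.trans h1)⟩
    · obtain ⟨X, h1, h2⟩ := exists_below_le _ _ h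
      exact ⟨X, f y, h1, le_rfl, h2, fun h => n2 (h.ge.trans h1)⟩
  have hinc := inc_of_level hl' hXY
  have hfw : ∀ w, w ≠ x → w ≠ y → X < f w ∧ Y < f w := fun w h1 h2 =>
    ⟨hX.trans_lt (f.lt_iff_lt.2 (hw w h1 h2).1), hY.trans_lt (f.lt_iff_lt.2 (hw w h1 h2).2)⟩
  let g : α → β := fun w => if w = x then X else if w = y then Y else f w
  have gx : g x = X := by simp [g]
  have gy : g y = Y := by simp [g, hne.symm]
  have gw : ∀ w, w ≠ x → w ≠ y → g w = f w := fun w h1 h2 => by simp [g, h1, h2]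
  have hg : ∀ u v, g u ≤ g v ↔ u ≤ v := by
    intro u v
    by_cases ux : u = x
    · subst ux
      by_cases vx : v = u
      · subst vx; simp
      by_cases vy : v = y
      · subst vy; rw [gx, gy]; exact iff_of_false hinc.1 hxy.1
      · rw [gx, gw v vx vy]; exact iff_of_true (hfw v vx vy).1.le (hw v vx vy).1.le
    by_cases uy : u = y
    · subst uy
      by_cases vy : v = u
      · subst vy; simp
      by_cases vx : v = x
      · subst vx; rw [gx, gy]; exact iff_of_false hinc.2 hxy.2
      · rw [gy, gw v vx vy]; exact iff_of_true (hfw v vx vy).2.le (hw v vx vy).2.le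
    rw [gw u ux uy]
    by_cases vx : v = x
    · subst vx; rw [gx]; exact iff_of_false (hfw u ux uy).1.not_ge (hw u ux uy).1.not_ge
    by_cases vy : v = y
    · subst vy; rw [gy]; exact iff_of_false (hfw u ux uy).2.not_ge (hw u ux uy).2.not_ge
    rw [gw v vx vy, f.le_iff_le]
  refine ⟨OrderEmbedding.ofMapLEIff g hg, li_of _ x y hl ?_ ht⟩
  simpa [gx, gy] using hl'

theorem case2 {α β : Type u} [PartialOrder α] [WellFoundedLT α]
    [PartialOrder β] [WellFoundedLT β] (f : α ↪o β) (x y z : α) (hxy : Incomp x y)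
    (hzy : Incomp z y) (hxz : x < z)
    (hw : ∀ w, w ≠ x → w ≠ y → w ≠ z → z < w ∧ y < w)
    (ht : ∀ u v, Incomp u v → (x ≤ u ∧ v = y) ∨ (x ≤ v ∧ u = y))
    (hl : level α x = level α y) : ∃ g : α ↪o β, LevelInduced g := by
  classical
  have hne : x ≠ y := fun h => hxy.1 h.le
  have hne2 : z ≠ y := fun h => hzy.1 h.le
  have n1 : ¬ f x ≤ f y := fun h => hxy.1 (f.le_iff_le.1 h)
  have n2 : ¬ f y ≤ f x := fun h => hxy.2 (f.le_iff_le.1 h)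
  have n3 : ¬ f z ≤ f y := fun h => hzy.1 (f.le_iff_le.1 h)
  have n4 : ¬ f y ≤ f z := fun h => hzy.2 (f.le_iff_le.1 h)
  have n5 : f x < f z := f.lt_iff_lt.2 hxz
  obtain ⟨X, Y, Z, hZ, hY, hl', hXY, hXZ, hZY⟩ : ∃ X Y Z, (Z ≤ f z ∨ Z ≤ f y) ∧
      (Y ≤ f z ∨ Y ≤ f y) ∧ level β X = level β Y ∧ Incomp X Y ∧ X < Z ∧ Incomp Z Y := by
    rcases le_total (level β (f x)) (level β (f y)) with h | h
    · obtain ⟨Y, h1, h2⟩ := exists_below_le _ _ h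
      have hi := inc_of_level h2.symm (fun h => n1 (h.le.trans h1))
      by_cases hYz : Y ≤ f z
      · refine ⟨Y, f x, f y, Or.inr le_rfl, Or.inl n5.le, h2, hi.symm, ?_, ⟨n2, n1⟩⟩
        refine lt_of_le_of_ne h1 ?_
        rintro rfl
        exact n4 hYz
      · exact ⟨f x, Y, f z, Or.inl le_rfl, Or.inr h1, h2.symm, hi, n5,
          ⟨fun h => n3 (h.trans h1), hYz⟩⟩
    · obtain ⟨X, h1, h2⟩ := exists_below_le _ _ h
      exact ⟨X, f y, f z, Or.inl le_rfl, Or.inr le_rfl, h2,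
        inc_of_level h2 (fun h => n2 (h.ge.trans h1)), h1.trans_lt n5, ⟨n3, n4⟩⟩
  have hfw : ∀ w, w ≠ x → w ≠ y → w ≠ z → Z < f w ∧ Y < f w := fun w h1 h2 h3 => by
    have a1 := f.lt_iff_lt.2 (hw w h1 h2 h3).1
    have a2 := f.lt_iff_lt.2 (hw w h1 h2 h3).2
    exact ⟨hZ.elim (fun h => h.trans_lt a1) (fun h => h.trans_lt a2),
      hY.elim (fun h => h.trans_lt a1) (fun h => h.trans_lt a2)⟩
  let g : α → β := fun w => if w = x then X else if w = y then Y else if w = z then Z else f w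
  have gx : g x = X := by simp [g]
  have gy : g y = Y := by simp [g, hne.symm]
  have gz : g z = Z := by simp [g, hne2, hxz.ne']
  have gw : ∀ w, w ≠ x → w ≠ y → w ≠ z → g w = f w := fun w h1 h2 h3 => by simp [g, h1, h2, h3]
  have hg : ∀ u v, g u ≤ g v ↔ u ≤ v := by
    intro u v
    have cu : u = x ∨ u = y ∨ u = z ∨ (u ≠ x ∧ u ≠ y ∧ u ≠ z) := by tauto
    have cv : v = x ∨ v = y ∨ v = z ∨ (v ≠ x ∧ v ≠ y ∧ v ≠ z) := by tauto
    rcases cu with hu | hu | hu | ⟨u1, u2, u3⟩ <;> rcases cv with hv | hv | hv | ⟨v1, v2, v3⟩ <;>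
      (try rw [hu]) <;> (try rw [hv]) <;> (try simp only [gx, gy, gz]) <;>
      (try rw [gw u u1 u2 u3]) <;> (try rw [gw v v1 v2 v3])
    · simp
    · exact iff_of_false hXY.1 hxy.1
    · exact iff_of_true hXZ.le hxz.le
    · exact iff_of_true (hXZ.trans (hfw v v1 v2 v3).1).le (hxz.trans (hw v v1 v2 v3).1).le
    · exact iff_of_false hXY.2 hxy.2
    · simp
    · exact iff_of_false hZY.2 hzy.2
    · exact iff_of_true (hfw v v1 v2 v3).2.le (hw v v1 v2 v3).2.le
    · exact iff_of_false hXZ.not_ge hxz.not_ge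
    · exact iff_of_false hZY.1 hzy.1
    · simp
    · exact iff_of_true (hfw v v1 v2 v3).1.le (hw v v1 v2 v3).1.le
    · exact iff_of_false (hXZ.trans (hfw u u1 u2 u3).1).not_ge (hxz.trans (hw u u1 u2 u3).1).not_ge
    · exact iff_of_false (hfw u u1 u2 u3).2.not_ge (hw u u1 u2 u3).2.not_ge
    · exact iff_of_false (hfw u u1 u2 u3).1.not_ge (hw u u1 u2 u3).1.not_ge
    · exact f.le_iff_le
  refine ⟨OrderEmbedding.ofMapLEIff g hg, li_of _ x y hl ?_ ht⟩
  simpa [gx, gy] using hl'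

theorem backward {α : Type u} [PartialOrder α] [Finite α] (h1 : ¬ HasObs1 α) (h2 : ¬ HasObs2 α)
    (h3 : ¬ HasAntichain3 α) (h4 : ¬ HasChain3PlusPoint α) : AliOrder α := by
  intro β _ _ ⟨f⟩
  have hV : ∀ a b c : α, a < b → a < c → b ≤ c ∨ c ≤ b := by
    intro a b c hb hc
    by_contra h
    push Not at h
    exact h2 ⟨a, b, c, hb, hc, h⟩
  by_cases hB : ∃ x z y : α, x < z ∧ Incomp x y ∧ Incomp z y
  · obtain ⟨x, z, y, hxz, hxy, hzy⟩ := hB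
    obtain ⟨hch, hmin, hZ⟩ := struct h1 h2 h3 hxz hxy hzy
    have hX : ∀ w, Incomp w y → w = x ∨ w = z := by
      intro w hw
      by_contra hn
      push Not at hn
      rcases hch w x hw hxy with h | h
      · exact h4 ⟨w, x, z, y, lt_of_le_of_ne h hn.1, hxz, hw, hxy, hzy⟩
      · have hxw := lt_of_le_of_ne h hn.1.symm
        rcases hch w z hw hzy with h | h
        · exact h4 ⟨x, w, z, y, hxw, lt_of_le_of_ne h hn.2, hxy, hw, hzy⟩
        · exact h4 ⟨x, z, w, y, hxz, lt_of_le_of_ne h hn.2.symm, hxy, hzy, hw⟩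
    have hw : ∀ w, w ≠ x → w ≠ y → w ≠ z → z < w ∧ y < w := by
      intro w wx wy wz
      have hyw : y < w := by
        by_contra h
        have a1 : ¬ y ≤ w := fun h' => h (lt_of_le_of_ne h' wy.symm)
        have a2 : ¬ w ≤ y := fun h' => hmin w (lt_of_le_of_ne h' wy)
        rcases hX w ⟨a2, a1⟩ with h | h
        · exact wx h
        · exact wz h
      exact ⟨hZ w z hyw hzy, hyw⟩
    have hxmin : ∀ e, ¬ e < x := by
      intro e he
      have b1 : e ≠ x := he.ne
      have b2 : e ≠ y := fun h => hxy.2 (h ▸ he.le)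
      have b3 : e ≠ z := fun h => lt_asymm hxz (h ▸ he)
      exact lt_asymm he (hxz.trans (hw e b1 b2 b3).1)
    have hxle : ∀ u, u ≠ y → x ≤ u := by
      intro u hu
      by_cases h : u = x
      · exact h.ge
      by_cases h' : u = z
      · exact h' ▸ hxz.le
      exact (hxz.trans (hw u h hu h').1).le
    refine case2 f x y z hxy hzy hxz hw ?_ ((lev0 hxmin).trans (lev0 hmin).symm)
    intro u v huv
    by_cases hu : u = y
    · refine Or.inr ⟨hxle v ?_, hu⟩
      rintro rfl
      exact huv.1 hu.le
    · by_cases hv : v = y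
      · exact Or.inl ⟨hxle u hu, hv⟩
      · exfalso
        rcases (hxle u hu).eq_or_lt with h | h
        · exact huv.1 (h ▸ hxle v hv)
        · rcases (hxle v hv).eq_or_lt with h' | h'
          · exact huv.2 (h' ▸ h.le)
          · rcases hV _ _ _ h h' with h | h
            · exact huv.1 h
            · exact huv.2 h
  · by_cases hI : ∃ x y : α, Incomp x y
    · obtain ⟨x, y, hxy⟩ := hI
      have huniq : ∀ x y w : α, Incomp x y → Incomp w y → w = x := by
        intro x y w hx hw
        by_contra hne
        by_cases c1 : w ≤ x
        · exact hB ⟨w, x, y, lt_of_le_of_ne c1 hne, hw, hx⟩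
        by_cases c2 : x ≤ w
        · exact hB ⟨x, w, y, lt_of_le_of_ne c2 (Ne.symm hne), hx, hw⟩
        exact h3 ⟨w, x, y, ⟨c1, c2⟩, hw, hx⟩
      have nlt : ∀ x y w : α, Incomp x y → ¬ w < x := by
        intro x y w h hw
        by_cases c1 : w ≤ y
        · rcases c1.eq_or_lt with c | c
          · exact h.2 (c ▸ hw.le)
          · rcases hV _ _ _ hw c with h' | h'
            · exact h.1 h'
            · exact h.2 h'
        by_cases c2 : y ≤ w
        · exact h.2 (c2.trans hw.le)
        exact hw.ne (huniq x y w h ⟨c1, c2⟩)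
      have gt : ∀ x y w : α, Incomp x y → w ≠ x → w ≠ y → x < w := by
        intro x y w h wx wy
        by_contra hn
        have a1 : ¬ x ≤ w := fun h' => hn (lt_of_le_of_ne h' wx.symm)
        have a2 : ¬ w ≤ x := fun h' => nlt x y w h (lt_of_le_of_ne h' wx)
        exact wy (huniq y x w h.symm ⟨a2, a1⟩)
      refine case1 f x y hxy (fun w wx wy => ⟨gt x y w hxy wx wy, gt y x w hxy.symm wy wx⟩) ?_
        ((lev0 (fun e => nlt x y e hxy)).trans (lev0 (fun e => nlt y x e hxy.symm)).symm)
      have hxle : ∀ u, u ≠ y → x ≤ u := by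
        intro u hu
        by_cases h : u = x
        · exact h.ge
        · exact (gt x y u hxy h hu).le
      intro u v huv
      by_cases hu : u = y
      · refine Or.inr ⟨hxle v ?_, hu⟩
        rintro rfl
        exact huv.1 hu.le
      · by_cases hv : v = y
        · exact Or.inl ⟨hxle u hu, hv⟩
        · exfalso
          rcases (hxle u hu).eq_or_lt with h | h
          · exact huv.1 (h ▸ hxle v hv)
          · rcases (hxle v hv).eq_or_lt with h' | h'
            · exact huv.2 (h' ▸ h.le)
            · rcases hV _ _ _ h h' with h | h
              · exact huv.1 h
              · exact huv.2 h
    · refine ⟨f, ?_⟩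
      intro u v
      constructor
      · intro h
        by_cases huv : u = v
        · rw [huv]
        · exact absurd ⟨u, v, inc_of_level h huv⟩ hI
      · intro h
        by_cases huv : u = v
        · rw [huv]
        · have := inc_of_level h (fun h => huv (f.injective h))
          refine absurd ⟨u, v, ?_⟩ hI
          exact ⟨fun h => this.1 (f.le_iff_le.2 h), fun h => this.2 (f.le_iff_le.2 h)⟩

end Ali

/-- A finite partial order is an ali order iff it contains no induced copy of `O_obs1`,
`O_obs2`, the antichain of size 3, or a 3-chain together with an incomparable element. -/
theorem stmt16 (α : Type u) [PartialOrder α] [Finite α] :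
    AliOrder α ↔
      ¬ HasObs1 α ∧ ¬ HasObs2 α ∧ ¬ HasAntichain3 α ∧ ¬ HasChain3PlusPoint α := by
  exact ⟨Ali.forward, fun h => Ali.backward h.1 h.2.1 h.2.2.1 h.2.2.2⟩
end

section
/- Let P' be a partial order with well-founded < that contains an induced suborder isomorphic to O_obs2 or an induced suborder isomorphic to O_obs3. Then there exists a partial order P with well-founded < and a level-induced order embedding of P' into P such that there exists no consecutive level-induced order embedding of P' into P. In particular, P' is not a nacli order. -/
universe u

theorem level_lex (α : Type u) [PartialOrder α] [WellFoundedLT α] (κ : Ordinal.{u})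
    (p : α ×ₗ κ.ToType) :
    level (α ×ₗ κ.ToType) p
      = κ * level α (ofLex p).1 + ((Ordinal.ToType.toOrd (ofLex p).2 : Set.Iio κ) : Ordinal) := by
  induction p using WellFoundedLT.induction with
  | ind p ih =>
  apply le_antisymm
  · unfold level
    rw [IsWellFounded.rank_eq]
    apply Ordinal.iSup_le
    rintro ⟨q, hq⟩
    apply Order.succ_le_of_lt
    have := ih q hq
    unfold level at this
    rw [this]
    rcases Prod.Lex.lt_iff.1 hq with h | ⟨h1, h2⟩
    · have h3 : IsWellFounded.rank (α := α) (· < ·) (ofLex q).1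
          < IsWellFounded.rank (α := α) (· < ·) (ofLex p).1 := IsWellFounded.rank_lt_of_rel h
      calc _ < κ * IsWellFounded.rank (α := α) (· < ·) (ofLex q).1 + κ := by
            gcongr
            exact (Ordinal.ToType.toOrd (ofLex q).2).2
        _ = κ * (Order.succ (IsWellFounded.rank (α := α) (· < ·) (ofLex q).1)) := by
            rw [Ordinal.mul_succ]
        _ ≤ κ * IsWellFounded.rank (α := α) (· < ·) (ofLex p).1 := by
            gcongr
            exact Order.succ_le_of_lt h3
        _ ≤ _ := le_self_add
    · have h1' : (ofLex q).1 = (ofLex p).1 := h1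
      rw [h1']
      gcongr
      exact Ordinal.ToType.mk.symm.lt_iff_lt.2 h2
  · apply le_of_forall_lt
    intro o ho
    have key : ∃ q, q < p ∧ o ≤ level (α ×ₗ κ.ToType) q := by
      have hκ : 0 < κ := lt_of_le_of_lt (zero_le) (Set.mem_Iio.1 (Ordinal.ToType.toOrd (ofLex p).2).2)
      rcases lt_or_ge o (κ * level α (ofLex p).1) with h | h
      · have hd : o / κ < level α (ofLex p).1 := (Ordinal.lt_mul_iff_div_lt hκ.ne').1 h
        have : ∃ y, y < (ofLex p).1 ∧ o / κ ≤ level α y := by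
          by_contra! hc
          refine absurd hd (not_lt.2 ?_)
          unfold level
          rw [IsWellFounded.rank_eq]
          apply Ordinal.iSup_le
          rintro ⟨y, hy⟩
          exact Order.succ_le_of_lt (hc y hy)
        obtain ⟨y, hy, hoy⟩ := this
        have hq : (toLex (y, Ordinal.ToType.mk ⟨o % κ, Ordinal.mod_lt _ hκ.ne'⟩) :
            α ×ₗ κ.ToType) < p := Prod.Lex.lt_iff.2 (Or.inl hy)
        refine ⟨_, hq, ?_⟩
        rw [ih _ hq]
        simp only [ofLex_toLex, Ordinal.ToType.toOrd, OrderIso.symm_apply_apply]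
        conv_lhs => rw [← Ordinal.div_add_mod o κ]
        gcongr
      · have hlt : o - κ * level α (ofLex p).1
            < ((Ordinal.ToType.toOrd (ofLex p).2 : Set.Iio κ) : Ordinal) := by
          rw [← add_lt_add_iff_left (κ * level α (ofLex p).1), Ordinal.add_sub_cancel_of_le h]
          exact ho
        have hq : (toLex ((ofLex p).1, Ordinal.ToType.mk ⟨o - κ * level α (ofLex p).1,
            hlt.trans (Ordinal.ToType.toOrd (ofLex p).2).2⟩) : α ×ₗ κ.ToType) < p := by
          refine Prod.Lex.lt_iff.2 (Or.inr ⟨rfl, ?_⟩)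
          simp only [ofLex_toLex]
          rw [← OrderIso.lt_symm_apply]
          exact hlt
        refine ⟨_, hq, ?_⟩
        rw [ih _ hq]
        simp only [ofLex_toLex, Ordinal.ToType.toOrd, OrderIso.symm_apply_apply]
        rw [Ordinal.add_sub_cancel_of_le h]
    obtain ⟨q, hq, hoq⟩ := key
    exact hoq.trans_lt (IsWellFounded.rank_lt_of_rel hq)

theorem main_aux (α : Type u) [PartialOrder α] [WellFoundedLT α] (x y : α)
    (H : ∀ (K : Type u) [LinearOrder K] (g : α ↪o α ×ₗ K),
      (ofLex (g x)).1 < (ofLex (g y)).1) :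
    ∃ (B : WFOrder.{u}) (f : α ↪o B.carrier), LevelInduced f ∧
      ∀ g : α ↪o B.carrier, ¬ ConsecutiveLevelInduced g := by
  obtain ⟨κ, hκ, habs⟩ : ∃ κ : Ordinal.{u}, max (level α x) (level α y) < κ ∧
      ∀ i < κ, i + κ = κ :=
    ⟨Ordinal.omega0 ^ (Order.succ (max (level α x) (level α y))),
      (Order.lt_succ _).trans_le (Ordinal.right_le_opow _ Ordinal.one_lt_omega0),
      fun i hi => Ordinal.add_omega0_opow hi⟩
  have h0 : 0 < κ := lt_of_le_of_lt (zero_le) hκ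
  let z : κ.ToType := Ordinal.ToType.mk ⟨0, h0⟩
  have hf : ∀ a b : α, (toLex (a, z) : α ×ₗ κ.ToType) ≤ toLex (b, z) ↔ a ≤ b := by
    intro a b
    rw [Prod.Lex.toLex_le_toLex, le_iff_lt_or_eq (a := a)]
    simp
  refine ⟨⟨α ×ₗ κ.ToType⟩, OrderEmbedding.ofMapLEIff (fun a => toLex (a, z)) hf, ?_, ?_⟩
  · intro a b
    change _ ↔ level (α ×ₗ κ.ToType) (toLex (a, z)) = level (α ×ₗ κ.ToType) (toLex (b, z))
    rw [level_lex, level_lex]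
    simp only [ofLex_toLex, z, Ordinal.ToType.toOrd, OrderIso.symm_apply_apply, add_zero]
    constructor
    · intro h
      rw [h]
    · intro h
      rcases lt_trichotomy (level α a) (level α b) with h' | h' | h'
      · exact absurd h (mul_lt_mul_of_pos_left h' h0).ne
      · exact h'
      · exact absurd h (mul_lt_mul_of_pos_left h' h0).ne'
  · intro g hg
    change α ↪o α ×ₗ κ.ToType at g
    have h1 := H _ g
    have h2 : gap α x y = gap (α ×ₗ κ.ToType) (g x) (g y) := hg x y
    have h3 : gap α x y < κ := (Ordinal.sub_le_self _ _).trans_lt hκ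
    have h4 : level α (ofLex (g x)).1 < level α (ofLex (g y)).1 :=
      IsWellFounded.rank_lt_of_rel h1
    have h5 : level (α ×ₗ κ.ToType) (g x) + κ ≤ level (α ×ₗ κ.ToType) (g y) := by
      rw [level_lex, level_lex, add_assoc, habs _ (Ordinal.ToType.toOrd _).2,
        ← Ordinal.mul_succ]
      refine le_trans ?_ le_self_add
      gcongr
      exact Order.succ_le_of_lt h4
    have h6 : level (α ×ₗ κ.ToType) (g x) ≤ level (α ×ₗ κ.ToType) (g y) :=
      le_self_add.trans h5
    have h7 : κ ≤ gap (α ×ₗ κ.ToType) (g x) (g y) := by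
      unfold gap
      rw [max_eq_right h6, min_eq_left h6]
      rw [← add_le_add_iff_left (level (α ×ₗ κ.ToType) (g x)), Ordinal.add_sub_cancel_of_le h6]
      exact h5
    rw [h2] at h3
    exact absurd h3 (not_lt.2 h7)

theorem lex_incomp {α K : Type u} [PartialOrder α] [LinearOrder K] {p q : α ×ₗ K}
    (h : Incomp p q) : ¬ (ofLex p).1 ≤ (ofLex q).1 ∧ ¬ (ofLex q).1 ≤ (ofLex p).1 := by
  obtain ⟨h1, h2⟩ := h
  rw [Prod.Lex.le_iff] at h1 h2
  push Not at h1 h2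
  constructor
  · intro h
    rcases h.lt_or_eq with h | h
    · exact h1.1 h
    · exact lt_asymm (h1.2 h) (h2.2 h.symm)
  · intro h
    rcases h.lt_or_eq with h | h
    · exact h2.1 h
    · exact lt_asymm (h2.2 h) (h1.2 h.symm)

theorem lex_fst_le {α K : Type u} [PartialOrder α] [LinearOrder K] {p q : α ×ₗ K}
    (h : p < q) : (ofLex p).1 ≤ (ofLex q).1 := by
  rcases Prod.Lex.lt_iff.1 h with h | h
  · exact h.le
  · exact h.1.le

/-- If a partial order with well-founded `<` contains an induced copy of `O_obs2` or of
`O_obs3`, then it has a level-induced embedding into some partial order with well-founded `<`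
admitting no consecutive level-induced embedding of it; in particular it is not nacli. -/
theorem stmt17 (α : Type u) [PartialOrder α] [WellFoundedLT α]
    (h : HasObs2 α ∨ HasObs3 α) :
    (∃ (B : WFOrder.{u}) (f : α ↪o B.carrier), LevelInduced f ∧
      ∀ g : α ↪o B.carrier, ¬ ConsecutiveLevelInduced g) ∧
    ¬ NacliOrder α := by
  have main : ∃ (B : WFOrder.{u}) (f : α ↪o B.carrier), LevelInduced f ∧
      ∀ g : α ↪o B.carrier, ¬ ConsecutiveLevelInduced g := by
    rcases h with ⟨a, b, c, hab, hac, hbc⟩ | ⟨a, b, c, hba, hca, hbc⟩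
    · refine main_aux α a b fun K _ g => ?_
      have hi : Incomp (g b) (g c) := ⟨by simpa using hbc.1, by simpa using hbc.2⟩
      have h1 := lex_fst_le (g.lt_iff_lt.2 hab)
      have h2 := lex_fst_le (g.lt_iff_lt.2 hac)
      refine lt_of_le_of_ne h1 fun he => (lex_incomp hi).1 ?_
      rw [← he]
      exact h2
    · refine main_aux α b a fun K _ g => ?_
      have hi : Incomp (g b) (g c) := ⟨by simpa using hbc.1, by simpa using hbc.2⟩
      have h1 := lex_fst_le (g.lt_iff_lt.2 hba)
      have h2 := lex_fst_le (g.lt_iff_lt.2 hca)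
      refine lt_of_le_of_ne h1 fun he => (lex_incomp hi).2 ?_
      rw [he]
      exact h2
  refine ⟨main, fun hn => ?_⟩
  obtain ⟨B, f, hf, hB⟩ := main
  obtain ⟨g, hg⟩ := hn B.carrier ⟨f, hf⟩
  exact hB g hg
end
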